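/- arXiv:2510.03554 — 2 statements merged into one kernel-verified Lean document; each statement's English description precedes it below -/
import Mathlib

section
/- Let G be a finite simple claw-free minimal 2-extendable graph with δ(G) ≥ 6, and let uv be an edge of G of type 2. Then N(u)∖{v} = N(v)∖{u}, where N(x) denotes the set of neighbors of x in G. -/
open SimpleGraph

/-- A graph `G` is `k`-extendable if it is connected, has a perfect matching, and every
matching of size `k` is contained in a perfect matching. -/
def KExt {V : Type*} [Fintype V] (G : SimpleGraph V) (k : ℕ) : Prop :=
  G.Connected ∧ (∃ P : G.Subgraph, P.IsPerfectMatching) ∧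
    ∀ M : G.Subgraph, M.IsMatching → M.edgeSet.ncard = k →
      ∃ P : G.Subgraph, P.IsPerfectMatching ∧ M ≤ P

/-- A `k`-extendable graph is minimal if deleting any edge destroys `k`-extendability. -/
def MinimalKExt {V : Type*} [Fintype V] (G : SimpleGraph V) (k : ℕ) : Prop :=
  KExt G k ∧ ∀ e ∈ G.edgeSet, ¬ KExt (G.deleteEdges {e}) k

/-- A graph is claw-free if it has no induced subgraph isomorphic to `K_{1,3}`. -/
def ClawFree {V : Type*} (G : SimpleGraph V) : Prop :=
  ∀ u a b c : V, G.Adj u a → G.Adj u b → G.Adj u c →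
    a ≠ b → a ≠ c → b ≠ c → ¬G.Adj a b → ¬G.Adj a c → ¬G.Adj b c → False

/-- The graph `G - e - S` obtained from `G` by deleting the edge `e = uv` and the vertices
of `S`. -/
def Ge {V : Type*} (G : SimpleGraph V) (u v : V) (S : Set V) : SimpleGraph ↑(Sᶜ) :=
  (G.deleteEdges {s(u, v)}).induce Sᶜ

/-- `S` is an admissible set for the edge `uv` (with parameter `k`): `S ⊆ V ∖ {u, v}`,
`G[S]` has a matching of size at least `k`, the number of odd components of `G - uv - S`
equals `|S| - 2k + 2`, and `u`, `v` lie in two distinct odd components of `G - uv - S`. -/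
def Admissible {V : Type*} [Fintype V] (G : SimpleGraph V) (k : ℕ) (u v : V) (S : Set V) :
    Prop :=
  u ∉ S ∧ v ∉ S ∧
  (∃ M : G.Subgraph, M.IsMatching ∧ M.verts ⊆ S ∧ k ≤ M.edgeSet.ncard) ∧
  Set.ncard {C : (Ge G u v S).ConnectedComponent | Odd C.supp.ncard} + 2 * k = S.ncard + 2 ∧
  ∃ (hu : u ∈ Sᶜ) (hv : v ∈ Sᶜ),
    (Ge G u v S).connectedComponentMk ⟨u, hu⟩ ≠ (Ge G u v S).connectedComponentMk ⟨v, hv⟩ ∧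
    Odd ((Ge G u v S).connectedComponentMk ⟨u, hu⟩).supp.ncard ∧
    Odd ((Ge G u v S).connectedComponentMk ⟨v, hv⟩).supp.ncard

/-- The edge `uv` has type `m` (`m = 4`: type 1, `m = 5`: type 2) if the minimum cardinality
of an admissible set for `uv` is `m`. -/
def EdgeType {V : Type*} [Fintype V] (G : SimpleGraph V) (u v : V) (m : ℕ) : Prop :=
  (∃ S : Set V, Admissible G 2 u v S ∧ S.ncard = m) ∧
  ∀ S : Set V, Admissible G 2 u v S → m ≤ S.ncard

/-- The consequences of `2`-extendability, claw-freeness and `δ ≥ 6` used below, in elementary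
form: perfect matchings are fixed-point-free involutions along edges. -/
structure Good {V : Type*} (G : SimpleGraph V) : Prop where
  conn : ∀ (A : Finset V) (a r : V), a ∈ A → r ∉ A → ∃ x ∈ A, ∃ y ∉ A, G.Adj x y
  claw : ClawFree G
  ext : ∀ a b c e, G.Adj a b → G.Adj c e → a ≠ c → a ≠ e → b ≠ c → b ≠ e →
    ∃ σ : V → V, (∀ x, σ (σ x) = x) ∧ (∀ x, G.Adj x (σ x)) ∧ σ a = b ∧ σ c = e
  deg : ∀ (x : V) (T : Finset V), T.card ≤ 5 → ∃ y ∉ T, G.Adj x y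

/-- `S` contains two disjoint edges of `G`. -/
def TwoEdges {V : Type*} (G : SimpleGraph V) (S : Finset V) : Prop :=
  ∃ a ∈ S, ∃ b ∈ S, ∃ c ∈ S, ∃ e ∈ S, G.Adj a b ∧ G.Adj c e ∧ a ≠ c ∧ a ≠ e ∧ b ≠ c ∧ b ≠ e

/-- All neighbours of vertices of `K` lie in `K ∪ S`. -/
def ClosedIn {V : Type*} (G : SimpleGraph V) (S K : Finset V) : Prop :=
  ∀ x ∈ K, ∀ y, G.Adj x y → y ∈ K ∨ y ∈ S

section

variable {V : Type*} {G : SimpleGraph V}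

theorem even_card_of_invariant {σ : V → V} (hσ : ∀ x, σ (σ x) = x) (hne : ∀ x, σ x ≠ x)
    (K : Finset V) (hK : ∀ x ∈ K, σ x ∈ K) : Even K.card := by
  have h : ∑ _x ∈ K, (1 : ZMod 2) = 0 :=
    Finset.sum_involution (fun x _ => σ x) (fun _ _ => by decide) (fun x _ _ => hne x)
      (fun x hx => hK x hx) (fun x _ => hσ x)
  simp only [Finset.sum_const, nsmul_eq_mul, mul_one] at h
  exact (ZMod.natCast_eq_zero_iff_even).1 h

theorem exists_exit {σ : V → V} (hσ : ∀ x, σ (σ x) = x) (hadj : ∀ x, G.Adj x (σ x))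
    {S K : Finset V} (hK : ClosedIn G S K) (hodd : Odd K.card) :
    ∃ x ∈ K, σ x ∈ S ∧ σ x ∉ K := by
  by_contra! h
  refine (Nat.not_even_iff_odd.2 hodd) (even_card_of_invariant hσ (fun x => (hadj x).ne') K ?_)
  intro x hx
  rcases hK x hx _ (hadj x) with h1 | h1
  · exact h1
  · exact h x hx h1

variable [DecidableEq V]

theorem Good.card_le (hG : Good G) {S : Finset V} (hS : TwoEdges G S) (F : Finset (Finset V))
    (hdis : ∀ K ∈ F, ∀ L ∈ F, K ≠ L → Disjoint K L) (hodd : ∀ K ∈ F, Odd K.card)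
    (hFS : ∀ K ∈ F, Disjoint K S) (hcl : ∀ K ∈ F, ClosedIn G S K) : F.card + 4 ≤ S.card := by
  obtain ⟨a, ha, b, hb, c, hc, e, he, hab, hce, h1, h2, h3, h4⟩ := hS
  obtain ⟨σ, hσ, hadj, hσa, hσc⟩ := hG.ext a b c e hab hce h1 h2 h3 h4
  have hex : ∀ K : Finset V, ∃ x, K ∈ F → x ∈ K ∧ σ x ∈ S := by
    intro K
    by_cases hK : K ∈ F
    · obtain ⟨x, hx, hx', -⟩ := exists_exit hσ hadj (hcl K hK) (hodd K hK)
      exact ⟨x, fun _ => ⟨hx, hx'⟩⟩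
    · exact ⟨a, fun h => absurd h hK⟩
  choose f hf using hex
  have hσb : σ b = a := by rw [← hσa, hσ]
  have hσe : σ e = c := by rw [← hσc, hσ]
  have hT : ({a, b, c, e} : Finset V) ⊆ S := by
    intro x hx; simp only [Finset.mem_insert, Finset.mem_singleton] at hx
    rcases hx with rfl | rfl | rfl | rfl <;> assumption
  have hTc : ({a, b, c, e} : Finset V).card = 4 := by
    have := hab.ne; have := hce.ne
    rw [Finset.card_insert_of_notMem, Finset.card_insert_of_notMem, Finset.card_insert_of_notMem,
      Finset.card_singleton] <;> simp_all
  have hle : F.card ≤ (S \ {a, b, c, e}).card := by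
    refine Finset.card_le_card_of_injOn (fun K => σ (f K)) ?_ ?_
    · intro K hK
      have hK' : K ∈ F := hK
      obtain ⟨hx, hx'⟩ := hf K hK'
      have hn : ∀ s ∈ S, f K ≠ s := fun s hs h =>
        Finset.disjoint_left.1 (hFS K hK') hx (h ▸ hs)
      have key : ∀ s t, t ∈ S → σ s = t → σ (f K) ≠ s := by
        intro s t ht hst h
        exact hn t ht (by rw [← hst, ← h, hσ])
      simp only [Finset.coe_sdiff, Set.mem_sdiff, Finset.mem_coe, Finset.mem_insert,
        Finset.mem_singleton]
      refine ⟨hx', ?_⟩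
      rintro (h | h | h | h)
      · exact key a b hb hσa h
      · exact key b a ha hσb h
      · exact key c e he hσc h
      · exact key e c hc hσe h
    · intro K hK L hL h
      have hK' : K ∈ F := hK
      have hL' : L ∈ F := hL
      have hfe : f K = f L := by
        have := congrArg σ h
        simpa [hσ] using this
      by_contra hne
      exact Finset.disjoint_left.1 (hdis K hK' L hL' hne) (hf K hK').1 (hfe ▸ (hf L hL').1)
  rw [Finset.card_sdiff_of_subset hT, hTc] at hle
  have := Finset.card_le_card hT
  omega

/-- A set closed up to the four ends of a `2`-matching is even. -/
theorem Good.even_card (hG : Good G) {S K : Finset V} (hS : TwoEdges G S) (hS4 : S.card = 4)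
    (hKS : Disjoint K S) (hK : ClosedIn G S K) : Even K.card := by
  by_contra h
  have := hG.card_le hS {K} (by simp +contextual) (by simpa using h) (by simpa using hKS)
    (by simpa using hK)
  simp [hS4] at this

theorem Good.even_sdiff (hG : Good G) {A : Finset V} {a b c e : V}
    (hA : ∀ x ∈ A, ∀ y, G.Adj x y → y ∈ A ∨ y = a ∨ y = b ∨ y = c ∨ y = e)
    (hab : G.Adj a b) (hce : G.Adj c e) (h1 : a ≠ c) (h2 : a ≠ e) (h3 : b ≠ c)
    (h4 : b ≠ e) : Even (A \ {a, b, c, e}).card := by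
  refine hG.even_card (S := {a, b, c, e}) ⟨a, by simp, b, by simp, c, by simp, e, by simp,
    hab, hce, h1, h2, h3, h4⟩ ?_ Finset.sdiff_disjoint ?_
  · have := hab.ne; have := hce.ne
    rw [Finset.card_insert_of_notMem, Finset.card_insert_of_notMem, Finset.card_insert_of_notMem,
      Finset.card_singleton] <;> simp_all
  · intro x hx y hxy
    have := hA x (Finset.mem_sdiff.1 hx).1 y hxy
    simp only [Finset.mem_sdiff, Finset.mem_insert, Finset.mem_singleton]
    tauto

end

section

variable {V : Type*} {G : SimpleGraph V} [DecidableEq V]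

/-- There is no cut vertex. -/
theorem Good.not_sep_one (hG : Good G) {A : Finset V} {a r x : V} (ha : a ∈ A) (hr : r ∉ A)
    (hrx : r ≠ x) (hA : ∀ w ∈ A, ∀ t, G.Adj w t → t ∈ A ∨ t = x) : False := by
  obtain ⟨w, hw, y, hy, hwy⟩ := hG.conn A a r ha hr
  obtain rfl : y = x := (hA w hw y hwy).resolve_left hy
  obtain ⟨z, hz, t, ht, hzt⟩ := hG.conn (insert y A) a r (by simp [ha]) (by simp [hr, hrx])
  have hzy : z = y := by
    rcases Finset.mem_insert.1 hz with h | h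
    · exact h
    · have := hA z h t hzt
      simp only [Finset.mem_insert] at ht; tauto
  subst hzy
  simp only [Finset.mem_insert, not_or] at ht
  obtain ⟨t', ht', htt'⟩ := hG.deg t {z} (by simp)
  obtain ⟨w', hw', hww'⟩ := hG.deg w {z} (by simp)
  simp only [Finset.mem_singleton] at ht' hw'
  have ht'A : t' ∉ A := fun h => by have := hA t' h t htt'.symm; tauto
  have hw'A : w' ∈ A := (hA w hw w' hww').resolve_right hw'
  have e1 := hG.even_sdiff (A := A) (a := z) (b := w) (c := t) (e := t')
    (fun x hx y h => by have := hA x hx y h; tauto) hwy.symm htt' (by grind) (by grind)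
    (by grind) (by grind)
  have e2 := hG.even_sdiff (A := A) (a := z) (b := t) (c := w) (e := w')
    (fun x hx y h => by have := hA x hx y h; tauto) hzt hww' (by grind) (by grind)
    (by grind) (by grind)
  have f1 : A \ {z, w, t, t'} = A.erase w := by ext; grind
  have f2 : A \ {z, t, w, w'} = (A.erase w).erase w' := by ext; grind
  have hne := hww'.ne
  rw [f1] at e1
  rw [f2, Finset.card_erase_of_mem (by grind)] at e2
  have : 0 < (A.erase w).card := Finset.card_pos.2 ⟨w', by grind⟩
  grind

/-- There is no `2`-vertex cut. -/
theorem Good.not_sep_two (hG : Good G) {A : Finset V} {a r x y : V} (ha : a ∈ A) (hr : r ∉ A)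
    (hrx : r ≠ x) (hry : r ≠ y) (hA : ∀ w ∈ A, ∀ t, G.Adj w t → t ∈ A ∨ t = x ∨ t = y) :
    False := by
  by_cases hx : x ∈ A
  · exact hG.not_sep_one ha hr hry (by grind)
  by_cases hy : y ∈ A
  · exact hG.not_sep_one ha hr hrx (by grind)
  by_cases hxy : x = y
  · exact hG.not_sep_one ha hr hrx (by grind)
  by_cases h1 : ∃ a₁ ∈ A, G.Adj x a₁
  swap
  · exact hG.not_sep_one ha hr hry (fun w hw t h => by have := hA w hw t h; grind [G.adj_comm])
  by_cases h2 : ∃ a₂ ∈ A, G.Adj y a₂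
  swap
  · exact hG.not_sep_one ha hr hrx (fun w hw t h => by have := hA w hw t h; grind [G.adj_comm])
  by_cases h3 : ∃ r₁, r₁ ∉ A ∧ r₁ ≠ y ∧ G.Adj x r₁
  swap
  · exact hG.not_sep_one (A := insert x A) (a := a) (by grind) (r := r) (by grind) hry (by grind)
  by_cases h4 : ∃ r₂, r₂ ∉ A ∧ r₂ ≠ x ∧ G.Adj y r₂
  swap
  · exact hG.not_sep_one (A := insert y A) (a := a) (by grind) (r := r) (by grind) hrx (by grind)
  obtain ⟨a₁, ha₁, hxa₁⟩ := h1
  obtain ⟨a₂, ha₂, hya₂⟩ := h2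
  obtain ⟨r₂, hr₂, hr₂x, hyr₂⟩ := h4
  have hne := hyr₂.ne
  have e1 := hG.even_sdiff (A := A) (a := x) (b := a₁) (c := y) (e := r₂)
    (fun x hx y h => by have := hA x hx y h; tauto) hxa₁ hyr₂ (by grind) (by grind)
    (by grind) (by grind)
  have f1 : A \ {x, a₁, y, r₂} = A.erase a₁ := by ext; grind
  rw [f1, Finset.card_erase_of_mem ha₁] at e1
  have hpos : 0 < A.card := Finset.card_pos.2 ⟨a, ha⟩
  suffices Even A.card by grind
  by_cases hadj : G.Adj x y
  · obtain ⟨b, hb, hab⟩ := hG.deg a {x, y} (Finset.card_le_two.trans (by norm_num))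
    have hbA : b ∈ A := by have := hA a ha b hab; grind
    have hne := hab.ne
    have e2 := hG.even_sdiff (A := A) (a := x) (b := y) (c := a) (e := b)
      (fun x hx y h => by have := hA x hx y h; tauto) hadj hab (by grind) (by grind)
      (by grind) (by grind)
    have f2 : A \ {x, y, a, b} = (A.erase a).erase b := by ext; grind
    rw [f2, Finset.card_erase_of_mem (by grind), Finset.card_erase_of_mem ha] at e2
    have : 0 < (A.erase a).card := Finset.card_pos.2 ⟨b, by grind⟩
    rw [Finset.card_erase_of_mem ha] at this
    grind
  · obtain ⟨b, hb, hxb⟩ := hG.deg x {a₂, r₂} (Finset.card_le_two.trans (by norm_num))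
    have hne' := hxb.ne
    have hne'' := hya₂.ne
    by_cases hbA : b ∈ A
    · have e2 := hG.even_sdiff (A := A) (a := x) (b := b) (c := y) (e := a₂)
        (fun x hx y h => by have := hA x hx y h; tauto) hxb hya₂ (by grind) (by grind)
        (by grind) (by grind)
      have f2 : A \ {x, b, y, a₂} = (A.erase b).erase a₂ := by ext; grind
      rw [f2, Finset.card_erase_of_mem (by grind), Finset.card_erase_of_mem hbA] at e2
      have : 0 < (A.erase b).card := Finset.card_pos.2 ⟨a₂, by grind⟩
      rw [Finset.card_erase_of_mem hbA] at this
      grind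
    · have e2 := hG.even_sdiff (A := A) (a := x) (b := b) (c := y) (e := r₂)
        (fun x hx y h => by have := hA x hx y h; tauto) hxb hyr₂ (by grind) (by grind)
        (by grind) (by grind)
      have f2 : A \ {x, b, y, r₂} = A := by ext; grind
      rwa [f2] at e2

/-- A `3`-vertex cut is independent. -/
theorem Good.not_sep_three (hG : Good G) {A : Finset V} {a r x y z : V} (hxy : G.Adj x y)
    (ha : a ∈ A) (hr : r ∉ A) (hrx : r ≠ x) (hry : r ≠ y) (hrz : r ≠ z)
    (hA : ∀ w ∈ A, ∀ t, G.Adj w t → t ∈ A ∨ t = x ∨ t = y ∨ t = z) : False := by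
  by_cases hx : x ∈ A
  · exact hG.not_sep_two ha hr hry hrz (by grind)
  by_cases hy : y ∈ A
  · exact hG.not_sep_two ha hr hrx hrz (by grind)
  by_cases hz : z ∈ A
  · exact hG.not_sep_two ha hr hrx hry (by grind)
  by_cases hzx : z = x
  · exact hG.not_sep_two ha hr hrx hry (by grind)
  by_cases hzy : z = y
  · exact hG.not_sep_two ha hr hrx hry (by grind)
  by_cases h1 : ∃ a₁ ∈ A, G.Adj z a₁
  swap
  · exact hG.not_sep_two ha hr hrx hry
      (fun w hw t h => by have := hA w hw t h; grind [G.adj_comm])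
  by_cases h2 : ∃ r₁, r₁ ∉ A ∧ r₁ ≠ x ∧ r₁ ≠ y ∧ G.Adj z r₁
  swap
  · exact hG.not_sep_two (A := insert z A) (a := a) (by grind) (r := r) (by grind) hrx hry
      (by grind)
  obtain ⟨a₁, ha₁, hza₁⟩ := h1
  obtain ⟨r₁, hr₁, hr₁x, hr₁y, hzr₁⟩ := h2
  have e1 := hG.even_sdiff (A := A) (a := x) (b := y) (c := z) (e := a₁)
    (fun x hx y h => by have := hA x hx y h; tauto) hxy hza₁ (by grind) (by grind)
    (by grind) (by grind)
  have e2 := hG.even_sdiff (A := A) (a := x) (b := y) (c := z) (e := r₁)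
    (fun x hx y h => by have := hA x hx y h; tauto) hxy hzr₁ (by grind) (by grind)
    (by grind) (by grind)
  have f1 : A \ {x, y, z, a₁} = A.erase a₁ := by ext; grind
  have f2 : A \ {x, y, z, r₁} = A := by ext; grind
  have hpos : 0 < A.card := Finset.card_pos.2 ⟨a, ha⟩
  rw [f1, Finset.card_erase_of_mem ha₁] at e1
  rw [f2] at e2
  grind

end

/-- `S` is a barrier for the edge `uv`: it contains two disjoint edges, and `G - uv - S` has
pairwise disjoint odd closed sets `A ∋ u`, `B ∋ v` and `|S| - 4` further ones, forming `F`. -/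
structure Barrier {V : Type*} (G : SimpleGraph V) (u v : V) (S A B : Finset V)
    (F : Finset (Finset V)) : Prop where
  two : TwoEdges G S
  left_mem : u ∈ A
  right_mem : v ∈ B
  odd_left : Odd A.card
  odd_right : Odd B.card
  left_right : ∀ x ∈ A, x ∉ B
  left_sep : ∀ x ∈ A, x ∉ S
  right_sep : ∀ x ∈ B, x ∉ S
  card_eq : F.card + 4 = S.card
  pairwise : ∀ K ∈ F, ∀ L ∈ F, K ≠ L → Disjoint K L
  odd_mem : ∀ K ∈ F, Odd K.card
  mem_sep : ∀ K ∈ F, ∀ x ∈ K, x ∉ S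
  mem_left : ∀ K ∈ F, ∀ x ∈ K, x ∉ A
  mem_right : ∀ K ∈ F, ∀ x ∈ K, x ∉ B
  closed_left : ∀ x ∈ A, ∀ y, G.Adj x y → y ∈ A ∨ y ∈ S ∨ (x = u ∧ y = v)
  closed_right : ∀ x ∈ B, ∀ y, G.Adj x y → y ∈ B ∨ y ∈ S ∨ (x = v ∧ y = u)
  closed_mem : ∀ K ∈ F, ∀ x ∈ K, ∀ y, G.Adj x y → y ∈ K ∨ y ∈ S

theorem Barrier.symm {V : Type*} {G : SimpleGraph V} {u v : V} {S A B : Finset V}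
    {F : Finset (Finset V)} (h : Barrier G u v S A B F) : Barrier G v u S B A F :=
  ⟨h.two, h.right_mem, h.left_mem, h.odd_right, h.odd_left, fun x hx hx' => h.left_right x hx' hx,
    h.right_sep, h.left_sep, h.card_eq, h.pairwise, h.odd_mem, h.mem_sep, h.mem_right, h.mem_left,
    h.closed_right, h.closed_left, h.closed_mem⟩

/-- No vertex can be removed from `S` so as to leave a barrier for `uv`. -/
def Irreducible2 {V : Type*} [DecidableEq V] (G : SimpleGraph V) (u v : V) (S : Finset V) : Prop :=
  ∀ d ∈ S, ∀ A B F, ¬ Barrier G u v (S.erase d) A B F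

theorem Irreducible2.symm {V : Type*} [DecidableEq V] {G : SimpleGraph V} {u v : V}
    {S : Finset V} (h : Irreducible2 G u v S) : Irreducible2 G v u S :=
  fun d hd A B F hB => h d hd B A F hB.symm

section

variable {V : Type*} {G : SimpleGraph V} [DecidableEq V] {u v : V} {S A B : Finset V}
  {F : Finset (Finset V)}

theorem Barrier.exists_adj_mem (hG : Good G) (h : Barrier G u v S A B F) {d : V} (hd : d ∈ S)
    (h2 : TwoEdges G (S.erase d)) : ∃ K ∈ F, ∃ k ∈ K, G.Adj d k := by
  by_contra! hn
  have hle := hG.card_le h2 F h.pairwise h.odd_mem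
    (fun K hK => Finset.disjoint_left.2 fun x hx hx' =>
      h.mem_sep K hK x hx (Finset.mem_of_mem_erase hx'))
    (fun K hK x hx y hxy => by
      rcases h.closed_mem K hK x hx y hxy with h1 | h1
      · exact Or.inl h1
      · refine Or.inr (Finset.mem_erase.2 ⟨?_, h1⟩)
        rintro rfl
        exact hn K hK x hx hxy.symm)
  have := h.card_eq
  rw [Finset.card_erase_of_mem hd] at hle
  omega

theorem Barrier.exists_adj_left (hG : Good G) (h : Barrier G u v S A B F)
    (hirr : Irreducible2 G u v S) {d : V} (hd : d ∈ S) (h2 : TwoEdges G (S.erase d)) :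
    ∃ a ∈ A, G.Adj d a := by
  by_contra! hn
  obtain ⟨K, hK, k, hk, hdk⟩ := h.exists_adj_mem hG hd h2
  have hkk : ∀ y, y ∉ K → y ∉ S → ¬ G.Adj k y := fun y hy hy' hky => by
    have := h.closed_mem K hK k hk y hky; tauto
  have hclaw := hG.claw
  have hcS := Finset.card_erase_of_mem hd
  have hcF := Finset.card_erase_of_mem hK
  have hcard := h.card_eq
  have hFpos : 0 < F.card := Finset.card_pos.2 ⟨K, hK⟩
  have hdK : ∀ L ∈ F, d ∉ L := fun L hL hdL => h.mem_sep L hL d hdL hd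
  have hdB : d ∉ B := fun hdL => h.right_sep d hdL hd
  by_cases hB : ∃ b ∈ B, G.Adj d b
  · obtain ⟨b, hb, hdb⟩ := hB
    have hub : ¬ G.Adj d u := hn u h.left_mem
    have hd1 : ∀ y, G.Adj d y → y ∈ S ∨ y ∈ B ∨ y ∈ K := by
      intro y hdy
      by_contra! hy
      obtain ⟨hyS, hyB, hyK⟩ := hy
      refine hclaw d b k y hdb hdk hdy (fun e => h.mem_right K hK k hk (e ▸ hb))
        (fun e => hyB (e ▸ hb)) (fun e => hyK (e ▸ hk))
        (fun e => hkk b (fun h' => h.mem_right K hK b h' hb) (h.right_sep b hb) e.symm)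
        (fun e => ?_) (hkk y hyK hyS)
      rcases h.closed_right b hb y e with h1 | h1 | h1
      · exact hyB h1
      · exact hyS h1
      · exact hub (h1.2 ▸ hdy)
    have hBK : Disjoint B K := Finset.disjoint_right.2 (h.mem_right K hK)
    refine hirr d hd A (insert d (B ∪ K)) (F.erase K) ⟨h2, h.left_mem, ?_, h.odd_left, ?_, ?_, ?_,
      ?_, ?_, ?_, ?_, ?_, ?_, ?_, ?_, ?_, ?_⟩
    · simp [h.right_mem]
    · rw [Finset.card_insert_of_notMem (by simp [hdB, hdK K hK]),
        Finset.card_union_of_disjoint hBK]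
      exact (h.odd_right.add_odd (h.odd_mem K hK)).add_one
    · intro x hx
      have h1 := h.left_right x hx
      have h3 : x ∉ K := fun hx' => h.mem_left K hK x hx' hx
      have h4 : x ≠ d := fun e => h.left_sep x hx (e ▸ hd)
      simp [h1, h3, h4]
    · exact fun x hx hx' => h.left_sep x hx (Finset.mem_of_mem_erase hx')
    · intro x hx hx'
      have := h.right_sep x
      have := h.mem_sep K hK x
      grind
    · omega
    · exact fun K hK L hL => h.pairwise K (Finset.mem_of_mem_erase hK) L
        (Finset.mem_of_mem_erase hL)
    · exact fun K hK => h.odd_mem K (Finset.mem_of_mem_erase hK)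
    · exact fun K hK x hx hx' => h.mem_sep K (Finset.mem_of_mem_erase hK) x hx
        (Finset.mem_of_mem_erase hx')
    · exact fun K hK => h.mem_left K (Finset.mem_of_mem_erase hK)
    · intro L hL x hx hx'
      have h1 := h.mem_right L (Finset.mem_of_mem_erase hL) x hx
      have h3 := Finset.disjoint_left.1
        (h.pairwise L (Finset.mem_of_mem_erase hL) K hK (Finset.ne_of_mem_erase hL)) hx
      have h4 := hdK L (Finset.mem_of_mem_erase hL)
      grind
    · intro x hx y hxy
      have := h.closed_left x hx y hxy
      have := hn x hx
      grind [G.adj_comm]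
    · intro x hx y hxy
      have := h.closed_right x
      have := h.closed_mem K hK x
      grind
    · intro L hL x hx y hxy
      have hL' := Finset.mem_of_mem_erase hL
      have h1 := h.closed_mem L hL' x hx y hxy
      have h3 := h.mem_right L hL' x hx
      have h4 := h.mem_sep L hL' x hx
      have h5 := Finset.disjoint_left.1 (h.pairwise L hL' K hK (Finset.ne_of_mem_erase hL)) hx
      have h6 := hd1 x
      grind [G.adj_comm]
  · push Not at hB
    have hcA : ∀ x ∈ A, ∀ y, G.Adj x y → y ∈ A ∨ y ∈ S.erase d ∨ (x = u ∧ y = v) := by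
      intro x hx y hxy
      have := h.closed_left x hx y hxy
      have := hn x hx
      grind [G.adj_comm]
    have hcB : ∀ x ∈ B, ∀ y, G.Adj x y → y ∈ B ∨ y ∈ S.erase d ∨ (x = v ∧ y = u) := by
      intro x hx y hxy
      have := h.closed_right x hx y hxy
      have := hB x hx
      grind [G.adj_comm]
    by_cases hL : ∃ L ∈ F, L ≠ K ∧ ∃ l ∈ L, G.Adj d l
    · obtain ⟨L, hL, hLK, l, hl, hdl⟩ := hL
      have hll : ∀ y, y ∉ L → y ∉ S → ¬ G.Adj l y := fun y hy hy' hly => by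
        have := h.closed_mem L hL l hl y hly; tauto
      have hdisj := h.pairwise L hL K hK hLK
      have hd1 : ∀ y, G.Adj d y → y ∈ S ∨ y ∈ L ∨ y ∈ K := by
        intro y hdy
        by_contra! hy
        obtain ⟨hyS, hyL, hyK⟩ := hy
        have hlK := Finset.disjoint_left.1 hdisj hl
        exact hclaw d k l y hdk hdl hdy (fun e => hlK (e ▸ hk))
          (fun e => hyK (e ▸ hk)) (fun e => hyL (e ▸ hl))
          (hkk l hlK (h.mem_sep L hL l hl)) (hkk y hyK hyS) (hll y hyL hyS)
      have hcL : ((F.erase K).erase L).card = (F.erase K).card - 1 :=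
        Finset.card_erase_of_mem (Finset.mem_erase.2 ⟨hLK, hL⟩)
      have hFK : 0 < (F.erase K).card := Finset.card_pos.2 ⟨L, Finset.mem_erase.2 ⟨hLK, hL⟩⟩
      have hnew : insert d (L ∪ K) ∉ (F.erase K).erase L := fun hh =>
        hdK _ (Finset.mem_of_mem_erase (Finset.mem_of_mem_erase hh)) (by simp)
      have hcN := Finset.card_insert_of_notMem hnew
      have hF' : ∀ M ∈ insert (insert d (L ∪ K)) ((F.erase K).erase L),
          M = insert d (L ∪ K) ∨ (M ∈ F ∧ M ≠ K ∧ M ≠ L) := by grind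
      have hdM : ∀ M ∈ F, M ≠ K → M ≠ L → Disjoint M (insert d (L ∪ K)) := by
        intro M hM hMK hML
        have h1 := h.pairwise M hM K hK hMK
        have h3 := h.pairwise M hM L hL hML
        rw [Finset.disjoint_insert_right, Finset.disjoint_union_right]
        exact ⟨hdK M hM, h3, h1⟩
      refine hirr d hd A B (insert (insert d (L ∪ K)) ((F.erase K).erase L)) ⟨h2, h.left_mem,
        h.right_mem, h.odd_left, h.odd_right, h.left_right, ?_, ?_, ?_, ?_, ?_, ?_, ?_, ?_,
        hcA, hcB, ?_⟩
      · exact fun x hx hx' => h.left_sep x hx (Finset.mem_of_mem_erase hx')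
      · exact fun x hx hx' => h.right_sep x hx (Finset.mem_of_mem_erase hx')
      · omega
      · intro M hM N hN hMN
        rcases hF' M hM with rfl | ⟨hM1, hM2, hM3⟩ <;> rcases hF' N hN with rfl | ⟨hN1, hN2, hN3⟩
        · exact absurd rfl hMN
        · exact (hdM N hN1 hN2 hN3).symm
        · exact hdM M hM1 hM2 hM3
        · exact h.pairwise M hM1 N hN1 hMN
      · intro M hM
        rcases hF' M hM with rfl | ⟨hM1, -, -⟩
        · rw [Finset.card_insert_of_notMem (by simp [hdK L hL, hdK K hK]),
            Finset.card_union_of_disjoint hdisj]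
          exact ((h.odd_mem L hL).add_odd (h.odd_mem K hK)).add_one
        · exact h.odd_mem M hM1
      · intro M hM x hx
        rcases hF' M hM with rfl | ⟨hM1, -, -⟩
        · have := h.mem_sep K hK x
          have := h.mem_sep L hL x
          grind
        · have := h.mem_sep M hM1 x
          grind
      · intro M hM x hx
        rcases hF' M hM with rfl | ⟨hM1, -, -⟩
        · have := h.mem_left K hK x
          have := h.mem_left L hL x
          have := h.left_sep x
          grind
        · exact h.mem_left M hM1 x hx
      · intro M hM x hx
        rcases hF' M hM with rfl | ⟨hM1, -, -⟩
        · have := h.mem_right K hK x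
          have := h.mem_right L hL x
          have := h.right_sep x
          grind
        · exact h.mem_right M hM1 x hx
      · intro M hM x hx y hxy
        rcases hF' M hM with rfl | ⟨hM1, hM2, hM3⟩
        · have := h.closed_mem K hK x
          have := h.closed_mem L hL x
          grind
        · have h1 := h.closed_mem M hM1 x hx y hxy
          have h3 := Finset.disjoint_left.1 (hdM M hM1 hM2 hM3) hx
          have h4 := h.mem_sep M hM1 x hx
          have h6 := hd1 x
          grind [G.adj_comm]
    · push Not at hL
      refine hirr d hd A B (F.erase K) ⟨h2, h.left_mem,
        h.right_mem, h.odd_left, h.odd_right, h.left_right, ?_, ?_, ?_, ?_, ?_, ?_, ?_, ?_,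
        hcA, hcB, ?_⟩
      · exact fun x hx hx' => h.left_sep x hx (Finset.mem_of_mem_erase hx')
      · exact fun x hx hx' => h.right_sep x hx (Finset.mem_of_mem_erase hx')
      · omega
      · exact fun K hK L hL => h.pairwise K (Finset.mem_of_mem_erase hK) L
          (Finset.mem_of_mem_erase hL)
      · exact fun K hK => h.odd_mem K (Finset.mem_of_mem_erase hK)
      · exact fun K hK x hx hx' => h.mem_sep K (Finset.mem_of_mem_erase hK) x hx
          (Finset.mem_of_mem_erase hx')
      · exact fun K hK => h.mem_left K (Finset.mem_of_mem_erase hK)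
      · exact fun K hK => h.mem_right K (Finset.mem_of_mem_erase hK)
      · intro L hLF x hx y hxy
        have h1 := h.closed_mem L (Finset.mem_of_mem_erase hLF) x hx y hxy
        have h3 := hL L (Finset.mem_of_mem_erase hLF) (Finset.ne_of_mem_erase hLF) x hx
        grind [G.adj_comm]

/-- A vertex of an irreducible barrier `S` whose removal leaves two disjoint edges is adjacent to
`u`, to `v` and to one further odd set, and to nothing else outside `S`. -/
theorem Barrier.neighbors (hG : Good G) (h : Barrier G u v S A B F)
    (hirr : Irreducible2 G u v S) {d : V} (hd : d ∈ S) (h2 : TwoEdges G (S.erase d)) :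
    G.Adj d u ∧ G.Adj d v ∧ ∃ K ∈ F, (∃ k ∈ K, G.Adj d k) ∧
      ∀ y, G.Adj d y → y ∈ S ∨ y = u ∨ y = v ∨ y ∈ K := by
  obtain ⟨K, hK, k, hk, hdk⟩ := h.exists_adj_mem hG hd h2
  obtain ⟨a₀, ha₀, hda₀⟩ := h.exists_adj_left hG hirr hd h2
  obtain ⟨b₀, hb₀, hdb₀⟩ := h.symm.exists_adj_left hG hirr.symm hd h2
  have hkk : ∀ y, y ∉ K → y ∉ S → ¬ G.Adj k y := fun y hy hy' hky => by
    have := h.closed_mem K hK k hk y hky; tauto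
  have key : ∀ a ∈ A, ∀ b ∈ B, G.Adj d a → G.Adj d b → a = u ∧ b = v := by
    intro a ha b hb hda hdb
    by_contra hne
    refine hG.claw d a b k hda hdb hdk (fun e => h.left_right a ha (e ▸ hb))
      (fun e => h.mem_left K hK k hk (e ▸ ha)) (fun e => h.mem_right K hK k hk (e ▸ hb))
      (fun e => ?_)
      (fun e => hkk a (fun h' => h.mem_left K hK a h' ha) (h.left_sep a ha) e.symm)
      (fun e => hkk b (fun h' => h.mem_right K hK b h' hb) (h.right_sep b hb) e.symm)
    rcases h.closed_left a ha b e with h1 | h1 | h1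
    · exact h.left_right b h1 hb
    · exact h.right_sep b hb h1
    · exact hne h1
  obtain ⟨rfl, rfl⟩ := key a₀ ha₀ b₀ hb₀ hda₀ hdb₀
  refine ⟨hda₀, hdb₀, K, hK, ⟨k, hk, hdk⟩, ?_⟩
  intro y hdy
  by_contra! hy
  obtain ⟨hyS, hyu, hyv, hyK⟩ := hy
  have hyA : y ∉ A := fun hyA => hyu (key y hyA b₀ hb₀ hdy hdb₀).1
  refine hG.claw d a₀ k y hda₀ hdk hdy (fun e => h.mem_left K hK k hk (e ▸ ha₀)) (Ne.symm hyu)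
    (fun e => hyK (e ▸ hk))
    (fun e => hkk a₀ (fun h' => h.mem_left K hK a₀ h' ha₀) (h.left_sep a₀ ha₀) e.symm)
    (fun e => ?_) (hkk y hyK hyS)
  have := h.closed_left a₀ ha₀ y e
  tauto

end

section

variable {V : Type*} {G : SimpleGraph V} [DecidableEq V] {u v : V} {S A B : Finset V}
  {F : Finset (Finset V)}

theorem twoEdges_erase {a b c e x : V} (ha : a ∈ S) (hb : b ∈ S) (hc : c ∈ S) (he : e ∈ S)
    (hab : G.Adj a b) (hce : G.Adj c e) (h1 : a ≠ c) (h2 : a ≠ e) (h3 : b ≠ c) (h4 : b ≠ e)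
    (hxa : x ≠ a) (hxb : x ≠ b) (hxc : x ≠ c) (hxe : x ≠ e) : TwoEdges G (S.erase x) :=
  ⟨a, Finset.mem_erase.2 ⟨hxa.symm, ha⟩, b, Finset.mem_erase.2 ⟨hxb.symm, hb⟩,
    c, Finset.mem_erase.2 ⟨hxc.symm, hc⟩, e, Finset.mem_erase.2 ⟨hxe.symm, he⟩,
    hab, hce, h1, h2, h3, h4⟩

theorem twoEdges_erase_of_three {a b c e f g x : V} (ha : a ∈ S) (hb : b ∈ S) (hc : c ∈ S)
    (he : e ∈ S) (hf : f ∈ S) (hg : g ∈ S) (hab : G.Adj a b) (hce : G.Adj c e) (hfg : G.Adj f g)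
    (hac : a ≠ c) (hae : a ≠ e) (hbc : b ≠ c) (hbe : b ≠ e) (hfa : f ≠ a) (hfb : f ≠ b)
    (hfc : f ≠ c) (hfe : f ≠ e) (hga : g ≠ a) (hgb : g ≠ b) (hgc : g ≠ c) (hge : g ≠ e) :
    TwoEdges G (S.erase x) := by
  by_cases h1 : x = a ∨ x = b
  · refine twoEdges_erase hc he hf hg hce hfg hfc.symm hgc.symm hfe.symm hge.symm ?_ ?_ ?_ ?_ <;>
      grind
  · by_cases h2 : x = c ∨ x = e
    · refine twoEdges_erase ha hb hf hg hab hfg hfa.symm hga.symm hfb.symm hgb.symm ?_ ?_ ?_ ?_ <;>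
        grind
    · exact twoEdges_erase ha hb hc he hab hce hac hae hbc hbe (by tauto) (by tauto) (by tauto)
        (by tauto)

theorem Barrier.not_adj_left (hG : Good G) (h : Barrier G u v S A B F)
    (hirr : Irreducible2 G u v S) {d w : V} (hd : d ∈ S) (h2 : TwoEdges G (S.erase d))
    (hw : w ∈ A) (hwu : w ≠ u) : ¬ G.Adj d w := by
  intro hdw
  obtain ⟨-, -, K, hK, -, hN⟩ := h.neighbors hG hirr hd h2
  rcases hN w hdw with h1 | h1 | h1 | h1
  · exact h.left_sep w hw h1
  · exact hwu h1
  · exact h.left_right w hw (h1 ▸ h.right_mem)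
  · exact h.mem_left K hK w h1 hw

theorem Barrier.adj_of_twoEdges (hG : Good G) (h : Barrier G u v S A B F)
    (hirr : Irreducible2 G u v S) {d d' w : V} (hw : w ∈ A) (huw : G.Adj u w) (hd : d ∈ S)
    (h2 : TwoEdges G (S.erase d)) (hd' : d' ∈ S) (h2' : TwoEdges G (S.erase d')) (hne : d ≠ d') :
    G.Adj d d' := by
  by_contra hdd
  have h3 := h.not_adj_left hG hirr hd h2 hw huw.ne'
  have h4 := h.not_adj_left hG hirr hd' h2' hw huw.ne'
  exact hG.claw u w d d' huw (h.neighbors hG hirr hd h2).1.symm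
    (h.neighbors hG hirr hd' h2').1.symm (fun e => h.left_sep w hw (e ▸ hd))
    (fun e => h.left_sep w hw (e ▸ hd')) hne (fun e => h3 e.symm) (fun e => h4 e.symm) hdd

theorem Barrier.exists_not_twoEdges (hG : Good G) (h : Barrier G u v S A B F)
    (hirr : Irreducible2 G u v S) {w : V} (hw : w ∈ A) (huw : G.Adj u w) :
    ∃ d ∈ S, ¬ TwoEdges G (S.erase d) := by
  by_contra! hall
  have hvA : v ∉ A := fun h' => h.left_right v h' h.right_mem
  refine hG.not_sep_one (A := A.erase u) (a := w) (r := v) (x := u) (by grind [huw.ne])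
    (by grind) (fun e => hvA (e ▸ h.left_mem)) ?_
  intro x hx t hxt
  have h1 := h.closed_left x (Finset.mem_of_mem_erase hx) t hxt
  have h2 : t ∉ S := fun ht => h.not_adj_left hG hirr ht (hall t ht)
    (Finset.mem_of_mem_erase hx) (Finset.ne_of_mem_erase hx) hxt.symm
  grind

/-- If `u` has a neighbour in `A`, an irreducible barrier `S` either has four elements, or five
elements one of which is isolated in `G[S]`. -/
theorem Barrier.card_four_or_five (hG : Good G) (h : Barrier G u v S A B F)
    (hirr : Irreducible2 G u v S) {w : V} (hw : w ∈ A) (huw : G.Adj u w) :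
    S.card = 4 ∨ S.card = 5 ∧ ∃ d ∈ S, TwoEdges G (S.erase d) ∧ ∀ x ∈ S, ¬ G.Adj d x := by
  have hcard := h.card_eq
  by_cases h4 : S.card = 4
  · exact Or.inl h4
  right
  have hadj := fun {d d' : V} => h.adj_of_twoEdges hG hirr (d := d) (d' := d') hw huw
  obtain ⟨q, hq, hq2⟩ := h.exists_not_twoEdges hG hirr hw huw
  obtain ⟨a, ha, b, hb, c, hc, e, he, hab, hce, hac, hae, hbc, hbe⟩ := h.two
  have hM : ({a, b, c, e} : Finset V).card ≤ 4 := Finset.card_le_four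
  obtain ⟨d, hd, hdM⟩ := Finset.exists_mem_notMem_of_card_lt_card
    (s := ({a, b, c, e} : Finset V)) (t := S) (by omega)
  simp only [Finset.mem_insert, Finset.mem_singleton, not_or] at hdM
  obtain ⟨hda, hdb, hdc, hde⟩ := hdM
  have hd2 : TwoEdges G (S.erase d) :=
    twoEdges_erase ha hb hc he hab hce hac hae hbc hbe hda hdb hdc hde
  have hS : ∀ x ∈ S, x = a ∨ x = b ∨ x = c ∨ x = e ∨ x = d := by
    intro f hf
    by_contra! hfn
    obtain ⟨hfa, hfb, hfc, hfe, hfd⟩ := hfn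
    have hdf := hadj hd hd2 hf
      (twoEdges_erase ha hb hc he hab hce hac hae hbc hbe hfa hfb hfc hfe) hfd.symm
    exact hq2 (twoEdges_erase_of_three ha hb hc he hd hf hab hce hdf hac hae hbc hbe hda hdb hdc
      hde hfa hfb hfc hfe)
  have hvA : v ∉ A := fun h' => h.left_right v h' h.right_mem
  have hvu : v ≠ u := fun h' => hvA (h' ▸ h.left_mem)
  have key : ∀ a b c e, a ∈ S → b ∈ S → c ∈ S → e ∈ S → G.Adj a b → G.Adj c e → a ≠ c → a ≠ e →
      b ≠ c → b ≠ e → d ≠ a → d ≠ b → d ≠ c → d ≠ e →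
      (∀ x ∈ S, x = a ∨ x = b ∨ x = c ∨ x = e ∨ x = d) → ¬ G.Adj d a := by
    intro a b c e ha hb hc he hab hce hac hae hbc hbe hda hdb hdc hde hS hdadj
    have hb2 : TwoEdges G (S.erase b) := twoEdges_erase hd ha hc he hdadj hce hdc hde hac hae
      hdb.symm hab.ne' hbc hbe
    have hdb' := hadj hd hd2 hb hb2 hdb
    have ha2 : TwoEdges G (S.erase a) := twoEdges_erase hd hb hc he hdb' hce hdc hde hbc hbe
      hda.symm hab.ne hac hae
    refine hG.not_sep_three (A := A.erase u) (a := w) (r := v) (x := c) (y := e) (z := u) hce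
      (by grind [huw.ne]) (by grind) (fun e => h.right_sep v h.right_mem (e ▸ hc))
      (fun e' => h.right_sep v h.right_mem (e' ▸ he)) hvu ?_
    intro x hx t hxt
    have hx1 := Finset.mem_of_mem_erase hx
    have hx2 := Finset.ne_of_mem_erase hx
    have h1 := h.closed_left x hx1 t hxt
    have h2 : t ≠ a := fun e => h.not_adj_left hG hirr ha ha2 hx1 hx2 (e ▸ hxt.symm)
    have h3 : t ≠ b := fun e => h.not_adj_left hG hirr hb hb2 hx1 hx2 (e ▸ hxt.symm)
    have h4 : t ≠ d := fun e => h.not_adj_left hG hirr hd hd2 hx1 hx2 (e ▸ hxt.symm)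
    have := hS t
    grind
  have hcd : S.card = 5 := by
    have h5 : S ⊆ {a, b, c, e, d} := fun x hx => by have := hS x hx; simpa using this
    have := (Finset.card_le_card h5).trans Finset.card_le_five
    omega
  refine ⟨hcd, d, hd, hd2, fun x hx => ?_⟩
  rcases hS x hx with rfl | rfl | rfl | rfl | rfl
  · exact key x b c e ha hb hc he hab hce hac hae hbc hbe hda hdb hdc hde hS
  · exact key x a c e hb ha hc he hab.symm hce hbc hbe hac hae hdb hda hdc hde
      (fun y hy => by have := hS y hy; tauto)
  · exact key x e a b hc he ha hb hce hab hac.symm hbc.symm hae.symm hbe.symm hdc hde hda hdb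
      (fun y hy => by have := hS y hy; tauto)
  · exact key x c a b he hc ha hb hce.symm hab hae.symm hbe.symm hac.symm hbc.symm hde hdc hda hdb
      (fun y hy => by have := hS y hy; tauto)
  · exact G.loopless.irrefl x

end

section

variable {V : Type*} {G : SimpleGraph V} {u v : V} {S A B : Finset V} {F : Finset (Finset V)}

theorem Barrier.left_notMem_sep (h : Barrier G u v S A B F) : u ∉ S := h.left_sep u h.left_mem

theorem Barrier.right_notMem_sep (h : Barrier G u v S A B F) : v ∉ S := h.right_sep v h.right_mem

theorem Barrier.right_notMem_left (h : Barrier G u v S A B F) : v ∉ A :=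
  fun h' => h.left_right v h' h.right_mem

theorem Barrier.left_notMem_right (h : Barrier G u v S A B F) : u ∉ B :=
  h.left_right u h.left_mem

theorem Barrier.not_adj_right (h : Barrier G u v S A B F) {p : V} (hp : p ∈ A) (hpu : p ≠ u) :
    ¬ G.Adj v p := by
  intro hvp
  rcases h.closed_left p hp v hvp.symm with h1 | h1 | h1
  · exact h.right_notMem_left h1
  · exact h.right_notMem_sep h1
  · exact hpu h1.1

end

section

variable {V : Type*} {G : SimpleGraph V} [DecidableEq V] {u v : V} {S A B : Finset V}
  {F : Finset (Finset V)}

theorem Barrier.exists_pair_adj_left (hG : Good G) (h : Barrier G u v S A B F)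
    (hirr : Irreducible2 G u v S) {d p : V} (hd : d ∈ S) (hd2 : TwoEdges G (S.erase d))
    (hp : p ∈ A) (hup : G.Adj u p) :
    ∃ x ∈ S, ∃ y ∈ S, x ≠ d ∧ y ≠ d ∧ x ≠ y ∧
      (∃ w ∈ A, w ≠ u ∧ G.Adj x w) ∧ (∃ w ∈ A, w ≠ u ∧ G.Adj y w) := by
  have key : ∀ x ∈ S, ∃ t ∈ S, t ≠ x ∧ t ≠ d ∧ ∃ w ∈ A, w ≠ u ∧ G.Adj t w := by
    intro x hx
    by_contra! hn
    refine hG.not_sep_two (A := A.erase u) (a := p) (r := v) (x := u) (y := x) (by grind [hup.ne])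
      (by grind [h.right_notMem_left]) (fun e => h.right_notMem_left (e ▸ h.left_mem))
      (fun e => h.right_notMem_sep (e ▸ hx)) ?_
    intro w hw t hwt
    have hw1 := Finset.mem_of_mem_erase hw
    have hw2 := Finset.ne_of_mem_erase hw
    have h1 := h.closed_left w hw1 t hwt
    have h2 := h.not_adj_left hG hirr hd hd2 hw1 hw2
    have := hn t
    grind [G.adj_comm]
  obtain ⟨x, hx, -, hxd, hxw⟩ := key d hd
  obtain ⟨y, hy, hyx, hyd, hyw⟩ := key x hx
  exact ⟨x, hx, y, hy, hxd, hyd, hyx.symm, hxw, hyw⟩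

theorem Barrier.exists_adj_right (hG : Good G) (h : Barrier G u v S A B F)
    (hirr : Irreducible2 G u v S) (h5 : S.card = 5) {p : V} (hp : p ∈ A) (hup : G.Adj u p) :
    ∃ y ∈ B, G.Adj v y := by
  by_contra! hn
  obtain ⟨d, hd, hd2, hdS⟩ : ∃ d ∈ S, TwoEdges G (S.erase d) ∧ ∀ x ∈ S, ¬ G.Adj d x := by
    rcases h.card_four_or_five hG hirr hp hup with h1 | h1
    · omega
    · exact h1.2
  obtain ⟨-, hdv, K, hK, ⟨k, hk, hdk⟩, -⟩ := h.neighbors hG hirr hd hd2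
  have hvS : ∀ x ∈ S, G.Adj v x := by
    intro x hx
    obtain ⟨y, hy, hvy⟩ := hG.deg v (insert u (S.erase x))
      ((Finset.card_insert_le _ _).trans (by rw [Finset.card_erase_of_mem hx]; omega))
    have h1 := h.closed_right v h.right_mem y hvy
    have h2 := hn y
    grind
  have hC : ∀ x ∈ S, ∀ y ∈ S, x ≠ d → y ≠ d → x ≠ y → G.Adj x y := by
    intro x hx y hy hxd hyd hxy
    by_contra hxy'
    exact hG.claw v d x y hdv.symm (hvS x hx) (hvS y hy) hxd.symm hyd.symm hxy (hdS x hx)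
      (hdS y hy) hxy'
  obtain ⟨x, hx, y, hy, hxd, hyd, hxy, hxw, hyw⟩ := h.exists_pair_adj_left hG hirr hd hd2 hp hup
  have hfar : ∀ x ∈ S, (∃ w ∈ A, w ≠ u ∧ G.Adj x w) → ∀ k ∈ K, ¬ G.Adj k x := by
    rintro x hx ⟨w, hw, hwu, hxw⟩ k hk hkx
    have h1 := h.closed_mem K hK k hk
    have h2 := h.mem_left K hK
    have h3 := h.mem_right K hK
    have h4 := h.left_sep w hw
    have h6 := h.right_notMem_sep
    have h7 := h.right_mem
    have h8 := h.closed_left w hw v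
    have h9 := h.right_notMem_left
    exact hG.claw x k w v hkx.symm hxw (hvS x hx).symm (by grind) (by grind) (by grind)
      (by grind) (by grind) (by grind)
  have hc : (((S.erase d).erase x).erase y).card = 2 := by
    rw [Finset.card_erase_of_mem (by grind), Finset.card_erase_of_mem (by grind),
      Finset.card_erase_of_mem hd, h5]
  obtain ⟨z, t, hzt, hzt'⟩ := Finset.card_eq_two.1 hc
  have hS : ∀ s ∈ S, s = d ∨ s = x ∨ s = y ∨ s = z ∨ s = t := by
    intro s hs
    have : s ∈ (((S.erase d).erase x).erase y) ↔ s ∈ ({z, t} : Finset V) := by rw [hzt']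
    grind
  have hz : z ∈ ((S.erase d).erase x).erase y := by simp [hzt']
  have ht : t ∈ ((S.erase d).erase x).erase y := by simp [hzt']
  have huS := h.left_notMem_sep
  refine hG.not_sep_three (A := K) (a := k) (r := u) (x := z) (y := t) (z := d)
    (hC z (by grind) t (by grind) (by grind) (by grind) hzt) hk
    (fun h' => h.mem_left K hK u h' h.left_mem) (by grind) (by grind) (by grind) ?_
  intro k' hk' s hs
  have h1 := h.closed_mem K hK k' hk' s hs
  have h2 := hS s
  have h3 := hfar x hx hxw k' hk'
  have h4 := hfar y hy hyw k' hk'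
  grind

end

section

variable {V : Type*} {G : SimpleGraph V} [DecidableEq V] {u v : V} {S A B : Finset V}
  {F : Finset (Finset V)} {d : V}

theorem Barrier.not_adj_of_adj_left (hG : Good G) (h : Barrier G u v S A B F)
    (hirr : Irreducible2 G u v S) (hd : d ∈ S) (hd2 : TwoEdges G (S.erase d))
    (hdS : ∀ x ∈ S, ¬ G.Adj d x) {q : V} (huq : G.Adj u q) (hqv : q ≠ v) : ¬ G.Adj d q := by
  rcases h.closed_left u h.left_mem q huq with h1 | h1 | h1
  · exact h.not_adj_left hG hirr hd hd2 h1 huq.ne'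
  · exact hdS q h1
  · exact absurd h1.2 hqv

theorem Barrier.adj_of_adj_left (hG : Good G) (h : Barrier G u v S A B F)
    (hirr : Irreducible2 G u v S) (hd : d ∈ S) (hd2 : TwoEdges G (S.erase d))
    (hdS : ∀ x ∈ S, ¬ G.Adj d x) {q q' : V} (huq : G.Adj u q) (hqv : q ≠ v) (hqd : q ≠ d)
    (huq' : G.Adj u q') (hqv' : q' ≠ v) (hqd' : q' ≠ d) (hne : q ≠ q') : G.Adj q q' := by
  by_contra hqq
  exact hG.claw u d q q' (h.neighbors hG hirr hd hd2).1.symm huq huq' hqd.symm hqd'.symm hne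
    (h.not_adj_of_adj_left hG hirr hd hd2 hdS huq hqv)
    (h.not_adj_of_adj_left hG hirr hd hd2 hdS huq' hqv') hqq

theorem Barrier.mem_of_common_neighbor (h : Barrier G u v S A B F) {q : V} (huq : G.Adj u q)
    (hvq : G.Adj v q) : q ∈ S := by
  have h1 := h.closed_left u h.left_mem q huq
  have h2 := h.closed_right v h.right_mem q hvq
  have h3 := h.left_right q
  have := hvq.ne
  have := huq.ne
  tauto

theorem Good.exists_three_adj (hG : Good G) (u v d p : V) :
    ∃ q₁ q₂ q₃, G.Adj u q₁ ∧ G.Adj u q₂ ∧ G.Adj u q₃ ∧ q₁ ≠ v ∧ q₁ ≠ d ∧ q₁ ≠ p ∧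
      q₂ ≠ v ∧ q₂ ≠ d ∧ q₂ ≠ p ∧ q₃ ≠ v ∧ q₃ ≠ d ∧ q₃ ≠ p ∧ q₁ ≠ q₂ ∧ q₁ ≠ q₃ ∧ q₂ ≠ q₃ := by
  obtain ⟨q₁, h1, hq1⟩ := hG.deg u {v, d, p} (Finset.card_le_three.trans (by norm_num))
  obtain ⟨q₂, h2, hq2⟩ := hG.deg u {v, d, p, q₁} (Finset.card_le_four.trans (by norm_num))
  obtain ⟨q₃, h3, hq3⟩ := hG.deg u {v, d, p, q₁, q₂} Finset.card_le_five
  simp only [Finset.mem_insert, Finset.mem_singleton, not_or] at h1 h2 h3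
  refine ⟨q₁, q₂, q₃, hq1, hq2, hq3, ?_⟩
  tauto

theorem Barrier.card_eq_four (hG : Good G) (h : Barrier G u v S A B F)
    (hirr : Irreducible2 G u v S) (huv : G.Adj u v) (hd : d ∈ S) (hd2 : TwoEdges G (S.erase d))
    (hdS : ∀ x ∈ S, ¬ G.Adj d x) {p : V} (hp : p ∈ A) (hup : G.Adj u p) {S' A' B' : Finset V}
    {F' : Finset (Finset V)} (h' : Barrier G u p S' A' B' F') (hirr' : Irreducible2 G u p S') :
    S'.card = 4 := by
  by_contra h4
  have hdu := (h.neighbors hG hirr hd hd2).1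
  have hvp : ¬ G.Adj v p := h.not_adj_right hp hup.ne'
  have hdp : ¬ G.Adj d p := h.not_adj_left hG hirr hd hd2 hp hup.ne'
  have hpv : p ≠ v := fun e => h.right_notMem_left (e ▸ hp)
  have hpd : p ≠ d := fun e => h.left_sep p hp (e ▸ hd)
  have hQ : ∀ q, G.Adj u q → q ≠ v → q ≠ d → ∀ q', G.Adj u q' → q' ≠ v → q' ≠ d → q ≠ q' →
      G.Adj q q' := fun q h1 h2 h3 q' h4 h5 h6 h7 =>
    h.adj_of_adj_left hG hirr hd hd2 hdS h1 h2 h3 h4 h5 h6 h7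
  have hQS : ∀ q, G.Adj u q → q ≠ v → q ≠ d → q ≠ p → q ∈ S' := fun q h1 h2 h3 h4 =>
    h'.mem_of_common_neighbor h1 (hQ p hup hpv hpd q h1 h2 h3 h4.symm)
  have hne : ∀ x ∈ S', TwoEdges G (S'.erase x) → G.Adj u x ∧ x ≠ v ∧ x ≠ d := by
    intro x hx hx2
    obtain ⟨h1, h2, -⟩ := h'.neighbors hG hirr' hx hx2
    exact ⟨h1.symm, fun e => hvp (e ▸ h2), fun e => hdp (e ▸ h2)⟩
  have hiso : ¬ ∃ x ∈ S', TwoEdges G (S'.erase x) ∧ ∀ y ∈ S', ¬ G.Adj x y := by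
    rintro ⟨x, hx, hx2, hxS⟩
    obtain ⟨hux, hxv, hxd⟩ := hne x hx hx2
    obtain ⟨q, hq, huq⟩ := hG.deg u {v, d, p, x} (Finset.card_le_four.trans (by norm_num))
    simp only [Finset.mem_insert, Finset.mem_singleton, not_or] at hq
    exact hxS q (hQS q huq hq.1 hq.2.1 hq.2.2.1)
      (hQ x hux hxv hxd q huq hq.1 hq.2.1 (Ne.symm hq.2.2.2))
  have hA' : ∀ w ∈ A', ¬ G.Adj u w := by
    intro w hw huw
    rcases h'.card_four_or_five hG hirr' hw huw with h1 | h1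
    · exact h4 h1
    · exact hiso h1.2
  have hB' : ∀ w ∈ B', ¬ G.Adj p w := by
    intro w hw hpw
    rcases h'.symm.card_four_or_five hG hirr'.symm hw hpw with h1 | h1
    · exact h4 h1
    · exact hiso h1.2
  have huS : ∀ x, G.Adj u x → x ≠ p → x ∈ S' := by
    intro x hux hxp
    have h1 := h'.closed_left u h'.left_mem x hux
    have h2 := hA' x
    tauto
  have hdS' := huS d hdu.symm hpd.symm
  have hvS' := huS v huv hpv.symm
  have hbig : 6 ≤ S'.card := by
    by_contra! hlt
    obtain ⟨y, hy, hpy⟩ := hG.deg p (insert u (S'.erase d)) (by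
      refine (Finset.card_insert_le _ _).trans ?_
      rw [Finset.card_erase_of_mem hdS']; omega)
    have h1 := h'.closed_right p h'.right_mem y hpy
    have h2 := hB' y
    grind [G.adj_comm]
  obtain ⟨a, ha, b, hb, c, hc, e, he, hab, hce, hac, hae, hbc, hbe⟩ := h'.two
  have hM : ({a, b, c, e} : Finset V).card ≤ 4 := Finset.card_le_four
  obtain ⟨f, hf, hfM⟩ := Finset.exists_mem_notMem_of_card_lt_card
    (s := ({a, b, c, e} : Finset V)) (t := S') (by omega)
  have hM' := Finset.card_insert_le f ({a, b, c, e} : Finset V)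
  obtain ⟨g, hg, hgM⟩ := Finset.exists_mem_notMem_of_card_lt_card
    (s := insert f ({a, b, c, e} : Finset V)) (t := S') (by omega)
  simp only [Finset.mem_insert, Finset.mem_singleton, not_or] at hfM hgM
  obtain ⟨hfa, hfb, hfc, hfe⟩ := hfM
  obtain ⟨hgf, hga, hgb, hgc, hge⟩ := hgM
  obtain ⟨hf1, hf2, hf3⟩ := hne f hf
    (twoEdges_erase ha hb hc he hab hce hac hae hbc hbe hfa hfb hfc hfe)
  obtain ⟨hg1, hg2, hg3⟩ := hne g hg
    (twoEdges_erase ha hb hc he hab hce hac hae hbc hbe hga hgb hgc hge)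
  exact (hne d hdS' (twoEdges_erase_of_three ha hb hc he hf hg hab hce
    (hQ f hf1 hf2 hf3 g hg1 hg2 hg3 (Ne.symm hgf)) hac hae hbc hbe hfa hfb hfc hfe hga hgb hgc
    hge)).2.2 rfl

end

theorem exists_and_of_pairs {a b c a' b' c' : Prop} (h1 : a ∨ b) (h2 : a ∨ c) (h3 : b ∨ c)
    (h1' : a' ∨ b') (h2' : a' ∨ c') (h3' : b' ∨ c') : a ∧ a' ∨ b ∧ b' ∨ c ∧ c' := by
  tauto

section

variable {V : Type*} {G : SimpleGraph V} [DecidableEq V] {u v : V} {S A B : Finset V}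
  {F : Finset (Finset V)} {d : V}

theorem Barrier.exists_adj_of_two (hG : Good G) (h : Barrier G u v S A B F) (h4 : S.card = 4)
    {q₁ q₂ q₃ s : V} (hq₃ : q₃ ∈ S) (hs : s ∈ S)
    (hS : ∀ x ∈ S, x = q₁ ∨ x = q₂ ∨ x = q₃ ∨ x = s) (huq : G.Adj u q₃) :
    (∃ w ∈ A, w ≠ u ∧ G.Adj q₁ w) ∨ (∃ w ∈ A, w ≠ u ∧ G.Adj q₂ w) := by
  by_contra! hn
  obtain ⟨hn1, hn2⟩ := hn
  obtain ⟨a, ha, hua⟩ := hG.deg u (insert v S) ((Finset.card_insert_le _ _).trans (by omega))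
  have haA : a ∈ A := by
    have := h.closed_left u h.left_mem a hua
    grind
  have hvA := h.right_notMem_left
  have hvS := h.right_notMem_sep
  refine hG.not_sep_three (A := A.erase u) (a := a) (r := v) (x := u) (y := q₃) (z := s) huq
    (by grind [hua.ne]) (by grind) (fun e => hvA (e ▸ h.left_mem)) (by grind) (by grind) ?_
  intro w hw t hwt
  have h1 := h.closed_left w (Finset.mem_of_mem_erase hw) t hwt
  have h2 := hS t
  have h3 := hn1 w
  have h5 := hn2 w
  grind [G.adj_comm]

theorem Barrier.eq_of_edge_barrier (hG : Good G) (h : Barrier G u v S A B F)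
    (hirr : Irreducible2 G u v S) (huv : G.Adj u v) (hd : d ∈ S) (hd2 : TwoEdges G (S.erase d))
    (hdS : ∀ x ∈ S, ¬ G.Adj d x) {p y : V} (hp : p ∈ A) (hup : G.Adj u p) (hy : y ∈ B)
    (hvy : G.Adj v y) {S' A' B' : Finset V} {F' : Finset (Finset V)}
    (h' : Barrier G u p S' A' B' F') (h4 : S'.card = 4) :
    ∃ q₁ q₂ q₃, G.Adj u q₁ ∧ G.Adj u q₂ ∧ G.Adj u q₃ ∧ q₁ ≠ v ∧ q₁ ≠ d ∧ q₁ ≠ p ∧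
      q₂ ≠ v ∧ q₂ ≠ d ∧ q₂ ≠ p ∧ q₃ ≠ v ∧ q₃ ≠ d ∧ q₃ ≠ p ∧ q₁ ≠ q₂ ∧ q₁ ≠ q₃ ∧ q₂ ≠ q₃ ∧
      S' = {q₁, q₂, q₃, y} ∧ ∀ x, G.Adj u x → x = q₁ ∨ x = q₂ ∨ x = q₃ ∨ x = v ∨ x = d ∨ x = p := by
  have hpv : p ≠ v := fun e => h.right_notMem_left (e ▸ hp)
  have hpd : p ≠ d := fun e => h.left_sep p hp (e ▸ hd)
  have hQ : ∀ q, G.Adj u q → q ≠ v → q ≠ d → ∀ q', G.Adj u q' → q' ≠ v → q' ≠ d → q ≠ q' →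
      G.Adj q q' := fun q h1 h2 h3 q' h4 h5 h6 h7 =>
    h.adj_of_adj_left hG hirr hd hd2 hdS h1 h2 h3 h4 h5 h6 h7
  have hpQ : ∀ q, G.Adj u q → q ≠ v → q ≠ d → q ≠ p → G.Adj p q := fun q h1 h2 h3 h4 =>
    hQ p hup hpv hpd q h1 h2 h3 h4.symm
  have hQS : ∀ q, G.Adj u q → q ≠ v → q ≠ d → q ≠ p → q ∈ S' := fun q h1 h2 h3 h4 =>
    h'.mem_of_common_neighbor h1 (hpQ q h1 h2 h3 h4)
  obtain ⟨q₁, q₂, q₃, hu1, hu2, hu3, h1v, h1d, h1p, h2v, h2d, h2p, h3v, h3d, h3p, h12, h13, h23⟩ :=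
    hG.exists_three_adj u v d p
  have hm1 := hQS q₁ hu1 h1v h1d h1p
  have hm2 := hQS q₂ hu2 h2v h2d h2p
  have hm3 := hQS q₃ hu3 h3v h3d h3p
  have hsplit : ∀ s ∈ S', s ≠ q₁ → s ≠ q₂ → s ≠ q₃ → S' = {q₁, q₂, q₃, s} := by
    intro s hs hs1 hs2 hs3
    refine (Finset.eq_of_subset_of_card_le ?_ ?_).symm
    · intro x; simp only [Finset.mem_insert, Finset.mem_singleton]; grind
    · rw [h4, Finset.card_insert_of_notMem, Finset.card_insert_of_notMem,
        Finset.card_insert_of_notMem, Finset.card_singleton] <;> grind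
  obtain ⟨s, hs, hs'⟩ := Finset.exists_mem_notMem_of_card_lt_card
    (s := ({q₁, q₂, q₃} : Finset V)) (t := S') (Finset.card_le_three.trans_lt (by omega))
  simp only [Finset.mem_insert, Finset.mem_singleton, not_or] at hs'
  have hSs := hsplit s hs hs'.1 hs'.2.1 hs'.2.2
  have hboth : ∃ g, G.Adj u g ∧ g ≠ v ∧ g ≠ d ∧ g ≠ p ∧ (∃ w ∈ A', w ≠ u ∧ G.Adj g w) ∧
      ∃ w ∈ B', w ≠ p ∧ G.Adj g w := by
    have a1 := h'.exists_adj_of_two hG h4 (q₁ := q₁) (q₂ := q₂) hm3 hs (by rw [hSs]; simp) hu3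
    have a2 := h'.exists_adj_of_two hG h4 (q₁ := q₁) (q₂ := q₃) hm2 hs (by rw [hSs]; simp [or_left_comm])
      hu2
    have a3 := h'.exists_adj_of_two hG h4 (q₁ := q₂) (q₂ := q₃) hm1 hs (by rw [hSs]; simp) hu1
    have b1 := h'.symm.exists_adj_of_two hG h4 (q₁ := q₁) (q₂ := q₂) hm3 hs (by rw [hSs]; simp)
      (hpQ q₃ hu3 h3v h3d h3p)
    have b2 := h'.symm.exists_adj_of_two hG h4 (q₁ := q₁) (q₂ := q₃) hm2 hs
      (by rw [hSs]; simp [or_left_comm]) (hpQ q₂ hu2 h2v h2d h2p)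
    have b3 := h'.symm.exists_adj_of_two hG h4 (q₁ := q₂) (q₂ := q₃) hm1 hs (by rw [hSs]; simp)
      (hpQ q₁ hu1 h1v h1d h1p)
    have c1 := exists_and_of_pairs a1 a2 a3 b1 b2 b3
    rcases c1 with c | c | c
    · exact ⟨q₁, hu1, h1v, h1d, h1p, c⟩
    · exact ⟨q₂, hu2, h2v, h2d, h2p, c⟩
    · exact ⟨q₃, hu3, h3v, h3d, h3p, c⟩
  obtain ⟨g, hug, hgv, hgd, hgp, ⟨w, hw, hwu, hgw⟩, w₁, hw₁, hw₁p, hgw₁⟩ := hboth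
  have hgS' := hQS g hug hgv hgd hgp
  have hdg : ¬ G.Adj d g := h.not_adj_of_adj_left hG hirr hd hd2 hdS hug hgv
  have huniq : ∀ w ∈ A', w ≠ u → G.Adj g w → w = v := by
    intro w hw hwu hgw
    have huw₁ : ¬ G.Adj u w₁ := fun e => by
      have h1 := h'.closed_left u h'.left_mem w₁ e
      have h2 := h'.left_right w₁
      have h3 := h'.right_sep w₁ hw₁
      tauto
    have hww₁ : ¬ G.Adj w₁ w := fun e => by
      have h1 := h'.closed_left w hw w₁ e.symm
      have h2 := h'.left_right w₁
      have h3 := h'.right_sep w₁ hw₁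
      tauto
    have huw : G.Adj u w := by
      by_contra huw
      exact hG.claw g u w₁ w hug.symm hgw₁ hgw (fun e => h'.left_right u h'.left_mem (e ▸ hw₁))
        hwu.symm (fun e => h'.left_right w hw (e ▸ hw₁)) huw₁ huw hww₁
    by_contra hwv
    exact h'.left_sep w hw (hQS w huw hwv (fun e => hdg (e ▸ hgw.symm))
      (fun e => h'.left_right w hw (e ▸ h'.right_mem)))
  obtain rfl := huniq w hw hwu hgw
  have hgA : g ∉ A := fun hg => h.not_adj_right hg hug.ne' hgw.symm
  have hgS : g ∈ S := by
    have := h.closed_left u h.left_mem g hug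
    tauto
  have hyg : G.Adj g y := h.symm.adj_of_adj_left hG hirr.symm hd hd2 hdS hgw.symm hug.ne' hgd hvy
    (fun e => h.left_notMem_right (e ▸ hy)) (fun e => h.right_sep y hy (e ▸ hd))
    (fun e => h.right_sep y hy (e ▸ hgS))
  have huy : ¬ G.Adj u y := h.symm.not_adj_right hy hvy.ne'
  have hyS' : y ∈ S' := by
    rcases h'.closed_left w hw y hvy with h1 | h1 | h1
    · exact absurd (huniq y h1 (fun e => h.left_notMem_right (e ▸ hy)) hyg) hvy.ne'
    · exact h1
    · exact absurd h1.1 hwu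
  have hSy := hsplit y hyS' (fun e => huy (e ▸ hu1)) (fun e => huy (e ▸ hu2))
    (fun e => huy (e ▸ hu3))
  refine ⟨q₁, q₂, q₃, hu1, hu2, hu3, h1v, h1d, h1p, h2v, h2d, h2p, h3v, h3d, h3p, h12, h13, h23,
    hSy, fun x hux => ?_⟩
  have h1 := hQS x hux
  by_contra! hx
  have h2 := h1 hx.2.2.2.1 hx.2.2.2.2.1 hx.2.2.2.2.2
  rw [hSy] at h2
  simp only [Finset.mem_insert, Finset.mem_singleton] at h2
  rcases h2 with h2 | h2 | h2 | h2
  · exact hx.1 h2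
  · exact hx.2.1 h2
  · exact hx.2.2.1 h2
  · exact huy (h2 ▸ hux)

end

section

variable {V : Type*} {G : SimpleGraph V} [DecidableEq V] {u v : V} {S A B : Finset V}
  {F : Finset (Finset V)} {d : V}

theorem eq_of_notMem_of_card_five (h5 : S.card = 5) {r₁ r₂ r₃ s t : V} (hd : d ∈ S) (h1 : r₁ ∈ S)
    (h2 : r₂ ∈ S) (h3 : r₃ ∈ S) (hs : s ∈ S) (ht : t ∈ S) (h12 : r₁ ≠ r₂) (h13 : r₁ ≠ r₃)
    (h23 : r₂ ≠ r₃) (hd1 : r₁ ≠ d) (hd2 : r₂ ≠ d) (hd3 : r₃ ≠ d) (hsd : s ≠ d) (hs1 : s ≠ r₁)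
    (hs2 : s ≠ r₂) (hs3 : s ≠ r₃) (htd : t ≠ d) (ht1 : t ≠ r₁) (ht2 : t ≠ r₂) (ht3 : t ≠ r₃) :
    s = t := by
  by_contra hst
  have hsub : ({s, t, d, r₁, r₂, r₃} : Finset V) ⊆ S := by
    intro x; simp only [Finset.mem_insert, Finset.mem_singleton]; grind
  have := Finset.card_le_card hsub
  rw [Finset.card_insert_of_notMem, Finset.card_insert_of_notMem, Finset.card_insert_of_notMem,
    Finset.card_insert_of_notMem, Finset.card_insert_of_notMem, Finset.card_singleton] at this <;>
    grind

set_option maxHeartbeats 600000 in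
/-- In the five-element case `u` has no neighbour in `A`. -/
theorem Barrier.not_adj_of_mem_left (hG : Good G)
    (hex : ∀ x y, G.Adj x y → ∃ S A B F, Barrier G x y S A B F ∧ Irreducible2 G x y S)
    (h : Barrier G u v S A B F) (hirr : Irreducible2 G u v S) (huv : G.Adj u v) (h5 : S.card = 5)
    {p : V} (hp : p ∈ A) : ¬ G.Adj u p := by
  intro hup
  obtain ⟨y, hy, hvy⟩ := h.exists_adj_right hG hirr h5 hp hup
  obtain ⟨d, hd, hd2, hdS⟩ : ∃ d ∈ S, TwoEdges G (S.erase d) ∧ ∀ x ∈ S, ¬ G.Adj d x := by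
    rcases h.card_four_or_five hG hirr hp hup with h1 | h1
    · omega
    · exact h1.2
  obtain ⟨-, -, K, hK, ⟨k, hk, hdk⟩, -⟩ := h.neighbors hG hirr hd hd2
  have hpv : p ≠ v := fun e => h.right_notMem_left (e ▸ hp)
  have hyu : y ≠ u := fun e => h.left_notMem_right (e ▸ hy)
  have hpd : p ≠ d := fun e => h.left_sep p hp (e ▸ hd)
  have hyd : y ≠ d := fun e => h.right_sep y hy (e ▸ hd)
  have hleft := fun {q q' : V} =>
    h.adj_of_adj_left hG hirr hd hd2 hdS (q := q) (q' := q')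
  have hright := fun {q q' : V} =>
    h.symm.adj_of_adj_left hG hirr.symm hd hd2 hdS (q := q) (q' := q')
  obtain ⟨S₁, A₁, B₁, F₁, hb₁, hi₁⟩ := hex u p hup
  have hc₁ := h.card_eq_four hG hirr huv hd hd2 hdS hp hup hb₁ hi₁
  obtain ⟨S₂, A₂, B₂, F₂, hb₂, hi₂⟩ := hex v y hvy
  have hc₂ := h.symm.card_eq_four hG hirr.symm huv.symm hd hd2 hdS hy hvy hb₂ hi₂
  obtain ⟨q₁, q₂, q₃, hu1, hu2, hu3, h1v, h1d, h1p, h2v, h2d, h2p, h3v, h3d, h3p, h12, h13, h23,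
    hS₁, hNu⟩ := h.eq_of_edge_barrier hG hirr huv hd hd2 hdS hp hup hy hvy hb₁ hc₁
  obtain ⟨r₁, r₂, r₃, hv1, hv2, hv3, h1u, h1d', h1y, h2u, h2d', h2y, h3u, h3d', h3y, g12, g13, g23,
    hS₂, hNv⟩ := h.symm.eq_of_edge_barrier hG hirr.symm huv.symm hd hd2 hdS hy hvy hp hup hb₂ hc₂
  clear hex hi₁ hi₂
  have hpuniq : ∀ x ∈ A, G.Adj u x → x = p := by
    intro x hx hux
    obtain ⟨_, _, _, -, -, -, -, -, -, -, -, -, -, -, -, -, -, -, hS₂', -⟩ :=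
      h.symm.eq_of_edge_barrier hG hirr.symm huv.symm hd hd2 hdS hy hvy hx hux hb₂ hc₂
    have hxS : x ∈ S₂ := by rw [hS₂']; simp
    have hvx := h.not_adj_right hx hux.ne'
    rw [hS₂] at hxS
    simp only [Finset.mem_insert, Finset.mem_singleton] at hxS
    grind
  have hyuniq : ∀ x ∈ B, G.Adj v x → x = y := by
    intro x hx hvx
    obtain ⟨_, _, _, -, -, -, -, -, -, -, -, -, -, -, -, -, -, -, hS₁', -⟩ :=
      h.eq_of_edge_barrier hG hirr huv hd hd2 hdS hp hup hx hvx hb₁ hc₁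
    have hxS : x ∈ S₁ := by rw [hS₁']; simp
    have hux := h.symm.not_adj_right hx hvx.ne'
    rw [hS₁] at hxS
    simp only [Finset.mem_insert, Finset.mem_singleton] at hxS
    grind
  have huS : ∀ q, G.Adj u q → q ≠ v → q ≠ p → q ∈ S := by
    intro q huq hqv hqp
    have h1 := h.closed_left u h.left_mem q huq
    have h2 := hpuniq q
    grind
  have hvS : ∀ q, G.Adj v q → q ≠ u → q ≠ y → q ∈ S := by
    intro q hvq hqu hqy
    have h1 := h.closed_right v h.right_mem q hvq
    have h2 := hyuniq q
    grind
  have hq1 := huS q₁ hu1 h1v h1p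
  have hq2 := huS q₂ hu2 h2v h2p
  have hq3 := huS q₃ hu3 h3v h3p
  have hr1 := hvS r₁ hv1 h1u h1y
  have hr2 := hvS r₂ hv2 h2u h2y
  have hr3 := hvS r₃ hv3 h3u h3y
  have huS' := h.left_notMem_sep
  have hvS' := h.right_notMem_sep
  have huout : ∀ s ∈ S, ∀ t ∈ S, s ≠ d → t ≠ d → ¬ G.Adj u s → ¬ G.Adj u t → s = t := by
    intro s hs t ht hsd htd hus hut
    refine eq_of_notMem_of_card_five h5 hd hq1 hq2 hq3 hs ht h12 h13 h23 h1d h2d h3d hsd ?_ ?_ ?_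
      htd ?_ ?_ ?_ <;> rintro rfl <;> contradiction
  have hvout : ∀ s ∈ S, ∀ t ∈ S, s ≠ d → t ≠ d → ¬ G.Adj v s → ¬ G.Adj v t → s = t := by
    intro s hs t ht hsd htd hus hut
    refine eq_of_notMem_of_card_five h5 hd hr1 hr2 hr3 hs ht g12 g13 g23 h1d' h2d' h3d' hsd ?_ ?_
      ?_ htd ?_ ?_ ?_ <;> rintro rfl <;> contradiction
  obtain ⟨x, hx, hx'⟩ := Finset.exists_mem_notMem_of_card_lt_card
    (s := ({d, q₁, q₂, q₃} : Finset V)) (t := S) (Finset.card_le_four.trans_lt (by omega))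
  simp only [Finset.mem_insert, Finset.mem_singleton, not_or] at hx'
  have hxp : x ≠ p := fun e => h.left_sep p hp (e ▸ hx)
  have hux : ¬ G.Adj u x := fun e => by
    have := hNu x e
    grind
  have hpy : ¬ G.Adj p y := fun e => by
    have h1 := h.closed_left p hp y e
    have h2 := h.left_right y
    have h3 := h.right_sep y hy
    have h4 := hup.ne
    grind
  have hKA : ∀ k ∈ K, ∀ t, t ∉ S → t ∉ K → ¬ G.Adj t k := fun k hk t ht ht' e => by
    have := h.closed_mem K hK k hk t e.symm
    tauto
  have hAK : ∀ t ∈ A, t ∉ K := fun t ht ht' => h.mem_left K hK t ht' ht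
  have hBK : ∀ t ∈ B, t ∉ K := fun t ht ht' => h.mem_right K hK t ht' ht
  have hcommon : ∀ z ∈ S, z ≠ d → G.Adj u z → G.Adj v z → ∀ k ∈ K, ¬ G.Adj z k := by
    intro z hz hzd huz hvz k hk hzk
    have hzp : z ≠ p := fun e => h.left_sep p hp (e ▸ hz)
    have hzy : z ≠ y := fun e => h.right_sep y hy (e ▸ hz)
    exact hG.claw z p y k (hleft huz (fun e => hvS' (e ▸ hz)) hzd hup hpv hpd hzp)
      (hright hvz (fun e => huS' (e ▸ hz)) hzd hvy hyu hyd hzy) hzk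
      (fun e => h.left_right p hp (e ▸ hy)) (fun e => hAK p hp (e ▸ hk))
      (fun e => hBK y hy (e ▸ hk)) hpy (hKA k hk p (h.left_sep p hp) (hAK p hp))
      (hKA k hk y (h.right_sep y hy) (hBK y hy))
  obtain ⟨z, hz, hzd, hz'⟩ : ∃ z ∈ S, z ≠ d ∧ ∀ t ∈ S, t ≠ d → t ≠ z → G.Adj v t := by
    by_cases hbad : ∃ z ∈ S, z ≠ d ∧ ¬ G.Adj v z
    · obtain ⟨z, hz, hzd, hvz⟩ := hbad
      exact ⟨z, hz, hzd, fun t ht htd htz => by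
        by_contra hvt
        exact htz (hvout t ht z hz htd hzd hvt hvz)⟩
    · push Not at hbad
      exact ⟨x, hx, hx'.1, fun t ht htd _ => hbad t ht htd⟩
  have hNK : ∀ k ∈ K, ∀ t, G.Adj k t → t ∈ K ∨ t = d ∨ t = z ∨ t = x := by
    intro k hk t hkt
    by_contra! hn
    obtain ⟨htK, htd, htz, htx⟩ := hn
    have htS := (h.closed_mem K hK k hk t hkt).resolve_left htK
    refine hcommon t htS htd ?_ (hz' t htS htd htz) k hk hkt.symm
    by_contra hut
    exact htx (huout t htS x hx htd hx'.1 hut hux)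
  have huK := hAK u h.left_mem
  have hud : u ≠ d := fun e => huS' (e ▸ hd)
  have hzu : u ≠ z := fun e => huS' (e ▸ hz)
  have hxu : u ≠ x := fun e => huS' (e ▸ hx)
  have hzx : z ≠ x := by
    rintro rfl
    exact hG.not_sep_two hk huK hud hzu (fun w hw t hwt => by have := hNK w hw t hwt; tauto)
  have hvx := hz' x hx hx'.1 hzx.symm
  obtain ⟨k', hk', hxk⟩ : ∃ k ∈ K, G.Adj x k := by
    by_contra! hn
    refine hG.not_sep_two hk huK hud hzu (fun w hw t hwt => ?_)
    have h1 := hNK w hw t hwt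
    have h2 := hn w hw
    grind [G.adj_comm]
  have hxy : G.Adj x y := hright hvx (Ne.symm hxu) hx'.1 hvy hyu hyd
    (fun e => h.right_sep y hy (e ▸ hx))
  have hxW : ∀ w ∈ A, w ≠ u → ¬ G.Adj x w := by
    intro w hw hwu hxw
    refine hG.claw x y k' w hxy hxk hxw (fun e => hBK y hy (e ▸ hk'))
      (fun e => h.left_right w hw (e ▸ hy)) (fun e => hAK w hw (e ▸ hk'))
      (hKA k' hk' y (h.right_sep y hy) (hBK y hy)) (fun e => ?_)
      (fun e => hKA k' hk' w (h.left_sep w hw) (hAK w hw) e.symm)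
    have h1 := h.closed_left w hw y e.symm
    have h2 := h.left_right y
    have h3 := h.right_sep y hy
    grind
  have hNW : ∀ w ∈ A, w ≠ u → ∀ t, G.Adj w t → (t ∈ A ∧ t ≠ u) ∨ (t = u ∧ w = p) ∨ t = q₁ ∨
      t = q₂ ∨ t = q₃ := by
    intro w hw hwu t hwt
    have h1 := h.closed_left w hw t hwt
    have h2 := hpuniq w hw
    have h3 := hxW w hw hwu
    have h4 := h.not_adj_left hG hirr hd hd2 hw hwu
    have h6 : t ∈ S → t = d ∨ t = x ∨ t = q₁ ∨ t = q₂ ∨ t = q₃ := by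
      intro htS
      by_contra! hn
      have hut : G.Adj u t := by
        by_contra hut
        exact hn.2.1 (huout t htS x hx hn.1 hx'.1 hut hux)
      have := hNu t hut
      have := h.left_sep p hp
      grind
    grind [G.adj_comm]
  clear hNK hcommon hright hKA hAK hBK hNv hvS huS hvout hz' hr1 hr2 hr3 hv1 hv2 hv3
  have hWS₁ : ∀ w ∈ A, w ∉ S₁ := by
    intro w hw hwS
    rw [hS₁] at hwS
    simp only [Finset.mem_insert, Finset.mem_singleton] at hwS
    have := h.left_sep w hw
    have := h.left_right w hw
    grind
  have hWB : ∀ w ∈ A, w ≠ u → w ∈ B₁ := by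
    intro w hw hwu
    by_contra hwB
    refine hG.not_sep_three (A := A.erase u \ B₁) (a := w) (r := v) (x := q₁) (y := q₂) (z := q₃)
      (hleft hu1 h1v h1d hu2 h2v h2d h12) (by grind) (by grind [h.right_notMem_left]) h1v.symm
      h2v.symm h3v.symm ?_
    intro s hs t hst
    simp only [Finset.mem_sdiff, Finset.mem_erase] at hs ⊢
    have h1 := hNW s hs.1.2 hs.1.1 t hst
    have h2 : t ∈ B₁ → _ := fun ht => hb₁.closed_right t ht s hst.symm
    have h3 := hb₁.right_mem
    have h4 := hWS₁ s hs.1.2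
    grind [G.adj_comm]
  have hqS₁ : ∀ t, t = q₁ ∨ t = q₂ ∨ t = q₃ → t ∉ B₁ := fun t ht htB =>
    hb₁.right_sep t htB (by rw [hS₁]; simp; tauto)
  have heven := hG.even_card (K := B₁ \ A.erase u) hb₁.two hc₁
    (Finset.disjoint_left.2 fun t ht => hb₁.right_sep t (Finset.mem_sdiff.1 ht).1) (by
      intro s hs t hst
      simp only [Finset.mem_sdiff, Finset.mem_erase] at hs ⊢
      have h1 := hb₁.closed_right s hs.1 t hst
      have h2 := hNW t
      have h3 := hqS₁ s
      have h4 := hb₁.left_notMem_right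
      grind [G.adj_comm])
  rw [Finset.card_sdiff_of_subset (fun w hw => hWB w (Finset.mem_of_mem_erase hw)
    (Finset.ne_of_mem_erase hw)), Finset.card_erase_of_mem h.left_mem] at heven
  have hle := Finset.card_le_card (s := A.erase u) (t := B₁) (fun w hw =>
    hWB w (Finset.mem_of_mem_erase hw) (Finset.ne_of_mem_erase hw))
  rw [Finset.card_erase_of_mem h.left_mem] at hle
  have h1 := h.odd_left
  have h2 := hb₁.odd_right
  grind

end

section

variable {V : Type*} {G : SimpleGraph V}

theorem exists_involution {P : G.Subgraph} (hP : P.IsPerfectMatching) :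
    ∃ σ : V → V, (∀ x, σ (σ x) = x) ∧ (∀ x, G.Adj x (σ x)) ∧ ∀ x y, P.Adj x y → σ x = y := by
  rw [Subgraph.isPerfectMatching_iff] at hP
  choose σ hσ hσ' using hP
  refine ⟨σ, fun x => (hσ' (σ x) x (hσ x).symm).symm, fun x => (hσ x).adj_sub,
    fun x y h => (hσ' x y h).symm⟩

theorem exists_isPerfectMatching {σ : V → V} (hσ : ∀ x, σ (σ x) = x)
    (hadj : ∀ x, G.Adj x (σ x)) :
    ∃ P : G.Subgraph, P.IsPerfectMatching ∧ ∀ x y, P.Adj x y ↔ σ x = y := by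
  refine ⟨⟨Set.univ, fun x y => σ x = y, fun h => h ▸ hadj _, fun _ => Set.mem_univ _,
    ⟨fun x y h => h ▸ hσ x⟩⟩, ?_, fun x y => Iff.rfl⟩
  rw [Subgraph.isPerfectMatching_iff]
  exact fun x => ⟨σ x, rfl, fun y h => Eq.symm (α := V) h⟩

theorem exists_matching_of_edges {a b c e : V} (hab : G.Adj a b) (hce : G.Adj c e) (h1 : a ≠ c)
    (h2 : a ≠ e) (h3 : b ≠ c) (h4 : b ≠ e) :
    ∃ M : G.Subgraph, M.IsMatching ∧ M.edgeSet = {s(a, b), s(c, e)} ∧ M.edgeSet.ncard = 2 ∧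
      M.verts = {a, b, c, e} := by
  have he : (G.subgraphOfAdj hab ⊔ G.subgraphOfAdj hce).edgeSet = {s(a, b), s(c, e)} := by
    rw [Subgraph.edgeSet_sup, edgeSet_subgraphOfAdj, edgeSet_subgraphOfAdj]
    rfl
  refine ⟨G.subgraphOfAdj hab ⊔ G.subgraphOfAdj hce,
    (Subgraph.IsMatching.subgraphOfAdj hab).sup (Subgraph.IsMatching.subgraphOfAdj hce) ?_, he,
    ?_, ?_⟩
  · rw [support_subgraphOfAdj, support_subgraphOfAdj, Set.disjoint_left]
    simp only [Set.mem_insert_iff, Set.mem_singleton_iff]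
    rintro x (rfl | rfl) (h | h) <;> contradiction
  · rw [he, Set.ncard_pair]
    simp only [ne_eq, Sym2.eq_iff]
    tauto
  · ext x
    simp only [Subgraph.verts_sup, subgraphOfAdj_verts, Set.mem_union, Set.mem_insert_iff,
      Set.mem_singleton_iff]
    tauto

theorem exists_edges_of_matching [Finite V] {M : G.Subgraph} (hM : M.IsMatching)
    (h2 : 2 ≤ M.edgeSet.ncard) :
    ∃ a b c e, M.Adj a b ∧ M.Adj c e ∧ s(a, b) ≠ s(c, e) ∧ a ≠ c ∧ a ≠ e ∧ b ≠ c ∧ b ≠ e := by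
  obtain ⟨f, g, hf, hg, hfg⟩ := (Set.one_lt_ncard_iff (Set.toFinite _)).1 h2
  induction f with | _ a b
  induction g with | _ c e
  have hab : M.Adj a b := hf
  have hce : M.Adj c e := hg
  have key : ∀ {x y z : V}, M.Adj x y → M.Adj x z → y = z := fun h h' => hM.eq_of_adj_left h h'
  refine ⟨a, b, c, e, hab, hce, hfg, ?_, ?_, ?_, ?_⟩ <;> rintro rfl
  · exact hfg (by rw [key hab hce])
  · exact hfg (by rw [key hab hce.symm, Sym2.eq_swap])
  · exact hfg (by rw [key hab.symm hce, Sym2.eq_swap])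
  · exact hfg (by rw [key hab.symm hce.symm])

theorem KExt.exists_involution [Fintype V] (h : KExt G 2) {a b c e : V} (hab : G.Adj a b)
    (hce : G.Adj c e) (h1 : a ≠ c) (h2 : a ≠ e) (h3 : b ≠ c) (h4 : b ≠ e) :
    ∃ σ : V → V, (∀ x, σ (σ x) = x) ∧ (∀ x, G.Adj x (σ x)) ∧ σ a = b ∧ σ c = e := by
  obtain ⟨M, hM, hMe, hM2, -⟩ := exists_matching_of_edges hab hce h1 h2 h3 h4
  obtain ⟨P, hP, hMP⟩ := h.2.2 M hM hM2
  obtain ⟨σ, hσ, hadj, hσP⟩ := _root_.exists_involution hP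
  have hle := Subgraph.edgeSet_mono hMP
  rw [hMe] at hle
  exact ⟨σ, hσ, hadj, hσP _ _ (hle (Set.mem_insert _ _)),
    hσP _ _ (hle (Set.mem_insert_of_mem _ rfl))⟩

theorem KExt.of_involution [Fintype V] (hconn : G.Connected) {τ : V → V} (hτ : ∀ x, τ (τ x) = x)
    (hτG : ∀ x, G.Adj x (τ x))
    (h : ∀ a b c e, G.Adj a b → G.Adj c e → a ≠ c → a ≠ e → b ≠ c → b ≠ e →
      ∃ σ : V → V, (∀ x, σ (σ x) = x) ∧ (∀ x, G.Adj x (σ x)) ∧ σ a = b ∧ σ c = e) :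
    KExt G 2 := by
  obtain ⟨P, hP, -⟩ := exists_isPerfectMatching hτ hτG
  refine ⟨hconn, ⟨P, hP⟩, fun M hM hM2 => ?_⟩
  obtain ⟨a, b, c, e, hab, hce, hne, h1, h2, h3, h4⟩ := exists_edges_of_matching hM hM2.ge
  obtain ⟨σ, hσ, hadj, hσa, hσc⟩ := h a b c e hab.adj_sub hce.adj_sub h1 h2 h3 h4
  obtain ⟨Q, hQ, hQσ⟩ := exists_isPerfectMatching hσ hadj
  have hMe' : M.edgeSet = {s(a, b), s(c, e)} := by
    refine (Set.eq_of_subset_of_ncard_le ?_ ?_ (Set.toFinite _)).symm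
    · rintro x (rfl | rfl)
      · exact hab
      · exact hce
    · rw [hM2, Set.ncard_pair hne]
  refine ⟨Q, hQ, fun x _ => hQ.2 x, fun x y hxy => ?_⟩
  have hmem : s(x, y) ∈ M.edgeSet := hxy
  rw [hMe'] at hmem
  rw [hQσ]
  simp only [Set.mem_insert_iff, Set.mem_singleton_iff, Sym2.eq_iff] at hmem
  rcases hmem with (⟨rfl, rfl⟩ | ⟨rfl, rfl⟩) | ⟨rfl, rfl⟩ | ⟨rfl, rfl⟩
  · exact hσa
  · rw [← hσa, hσ]
  · exact hσc
  · rw [← hσc, hσ]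

theorem good_of_kExt [Fintype V] [DecidableRel G.Adj] (hclaw : ClawFree G) (hext : KExt G 2)
    (hdelta : 6 ≤ G.minDegree) : Good G := by
  refine ⟨?_, hclaw, fun a b c e => hext.exists_involution, ?_⟩
  · intro A a r ha hr
    by_contra! hn
    have hreach : ∀ x, G.Reachable a x → x ∈ A := by
      intro x hx
      rw [reachable_iff_reflTransGen] at hx
      induction hx with
      | refl => exact ha
      | tail _ hxy ih =>
        by_contra hy
        exact hn _ ih _ hy hxy
    exact hr (hreach r (hext.1.preconnected a r))
  · intro x T hT
    have hd := hdelta.trans (G.minDegree_le_degree x)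
    rw [← card_neighborFinset_eq_degree] at hd
    obtain ⟨y, hy, hyT⟩ := Finset.exists_mem_notMem_of_card_lt_card
      (s := T) (t := G.neighborFinset x) (by omega)
    exact ⟨y, hyT, (mem_neighborFinset ..).1 hy⟩

end

section

open Classical in
/-- The vertices of a connected component of a graph on a subtype, as a finset of the type. -/
noncomputable def compFinset {V : Type*} [Fintype V] {s : Set V} {D : SimpleGraph s}
    (C : D.ConnectedComponent) : Finset V :=
  Finset.univ.filter fun x => ∃ h : x ∈ s, D.connectedComponentMk ⟨x, h⟩ = C

variable {V : Type*} [Fintype V] {s : Set V} {D : SimpleGraph s}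

theorem mem_compFinset {C : D.ConnectedComponent} {x : V} :
    x ∈ compFinset C ↔ ∃ h : x ∈ s, D.connectedComponentMk ⟨x, h⟩ = C := by
  simp [compFinset]

theorem card_compFinset (C : D.ConnectedComponent) : (compFinset C).card = C.supp.ncard := by
  rw [← Set.ncard_image_of_injective C.supp Subtype.val_injective, ← Set.ncard_coe_finset]
  congr 1
  ext x
  simp [mem_compFinset]

theorem disjoint_compFinset {C C' : D.ConnectedComponent} (h : C ≠ C') :
    Disjoint (compFinset C) (compFinset C') := by
  rw [Finset.disjoint_left]
  intro x hx hx'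
  obtain ⟨h1, h2⟩ := mem_compFinset.1 hx
  obtain ⟨h3, h4⟩ := mem_compFinset.1 hx'
  exact h (h2.symm.trans h4)

theorem compFinset_injective : Function.Injective (compFinset (D := D)) := by
  intro C C' h
  by_contra hne
  obtain ⟨x, hx⟩ := C.exists_rep
  have hx' : (x : V) ∈ compFinset C := mem_compFinset.2 ⟨x.2, hx⟩
  exact Finset.disjoint_left.1 (disjoint_compFinset hne) hx' (h ▸ hx')

theorem compFinset_closed {C : D.ConnectedComponent} {x y : V} (hx : x ∈ compFinset C)
    (hy : y ∈ s) (h : ∀ (h₁ : x ∈ s) (h₂ : y ∈ s), D.Adj ⟨x, h₁⟩ ⟨y, h₂⟩) : y ∈ compFinset C := by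
  obtain ⟨h1, h2⟩ := mem_compFinset.1 hx
  exact mem_compFinset.2 ⟨hy, h2 ▸ (ConnectedComponent.sound (h h1 hy).reachable).symm⟩

theorem compFinset_subset {x : s} {A : Finset V} (hx : (x : V) ∈ A)
    (hA : ∀ y z : s, (y : V) ∈ A → D.Adj y z → (z : V) ∈ A) :
    compFinset (D.connectedComponentMk x) ⊆ A := by
  intro y hy
  obtain ⟨h1, h2⟩ := mem_compFinset.1 hy
  have hr : ∀ z, D.Reachable x z → (z : V) ∈ A := by
    intro z hz
    rw [reachable_iff_reflTransGen] at hz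
    induction hz with
    | refl => exact hx
    | tail _ hxy ih => exact hA _ _ ih hxy
  exact hr _ (ConnectedComponent.exact h2).symm

/-- Tutte's theorem, in terms of families of odd closed sets. -/
theorem exists_family_of_no_involution {W : Type*} [Fintype W] [DecidableEq W] {H : SimpleGraph W}
    (heven : Even (Fintype.card W))
    (hH : ¬ ∃ σ : W → W, (∀ x, σ (σ x) = x) ∧ ∀ x, H.Adj x (σ x)) :
    ∃ (T : Finset W) (F : Finset (Finset W)), (∀ K ∈ F, ∀ L ∈ F, K ≠ L → Disjoint K L) ∧
      (∀ K ∈ F, Odd K.card) ∧ (∀ K ∈ F, Disjoint K T) ∧ (∀ K ∈ F, ClosedIn H T K) ∧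
      T.card + 2 ≤ F.card := by
  classical
  have hnot : ¬ ∃ M : H.Subgraph, M.IsPerfectMatching := by
    rintro ⟨M, hM⟩
    obtain ⟨σ, h1, h2, -⟩ := exists_involution hM
    exact hH ⟨σ, h1, h2⟩
  rw [tutte] at hnot
  push Not at hnot
  obtain ⟨T, hT⟩ := hnot
  have hT' : T.ncard <
    ((⊤ : H.Subgraph).deleteVerts T).coe.oddComponents.ncard := hT
  have hs : ∀ x, x ∈ ((⊤ : H.Subgraph).deleteVerts T).verts ↔ x ∉ T := by simp
  set F := ((⊤ : H.Subgraph).deleteVerts T).coe.oddComponents.toFinset.image compFinset with hF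
  have hFmem : ∀ K, K ∈ F ↔ ∃ C ∈ ((⊤ : H.Subgraph).deleteVerts T).coe.oddComponents,
      compFinset C = K := by simp [hF]
  have hcard : F.card = ((⊤ : H.Subgraph).deleteVerts T).coe.oddComponents.ncard := by
    rw [hF, Finset.card_image_of_injective _ compFinset_injective, Set.ncard_eq_toFinset_card']
  have hpw : ∀ K ∈ F, ∀ L ∈ F, K ≠ L → Disjoint K L := by
    intro K hK L hL hne
    obtain ⟨C, -, rfl⟩ := (hFmem K).1 hK
    obtain ⟨C', -, rfl⟩ := (hFmem L).1 hL
    exact disjoint_compFinset (fun e => hne (e ▸ rfl))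
  have hodd : ∀ K ∈ F, Odd K.card := by
    intro K hK
    obtain ⟨C, hC, rfl⟩ := (hFmem K).1 hK
    rw [card_compFinset]
    exact hC
  have hdis : ∀ K ∈ F, Disjoint K T.toFinset := by
    intro K hK
    obtain ⟨C, hC, rfl⟩ := (hFmem K).1 hK
    rw [Finset.disjoint_left]
    intro x hx
    obtain ⟨h1, -⟩ := mem_compFinset.1 hx
    simpa using (hs x).1 h1
  have hcl : ∀ K ∈ F, ClosedIn H T.toFinset K := by
    intro K hK
    obtain ⟨C, hC, rfl⟩ := (hFmem K).1 hK
    intro x hx y hxy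
    by_cases hy : y ∈ T
    · exact Or.inr (by simpa using hy)
    · obtain ⟨h1, -⟩ := mem_compFinset.1 hx
      exact Or.inl (compFinset_closed hx ((hs y).2 hy)
        (fun _ _ => by simpa [(hs x).1 h1, hy] using hxy))
  have hTc : T.toFinset.card = T.ncard := (Set.ncard_eq_toFinset_card' T).symm
  by_cases h2 : T.toFinset.card + 2 ≤ F.card
  · exact ⟨T.toFinset, F, hpw, hodd, hdis, hcl, h2⟩
  have hFc : F.card = T.toFinset.card + 1 := by omega
  set R := (Finset.univ \ F.biUnion id) \ T.toFinset with hR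
  have hRmem : ∀ x, x ∈ R ↔ (∀ K ∈ F, x ∉ K) ∧ x ∉ T.toFinset := by
    intro x
    simp [hR]
  have hUT : Disjoint (F.biUnion id) T.toFinset := by
    rw [Finset.disjoint_biUnion_left]
    exact hdis
  have hRc : R.card + T.toFinset.card + ∑ K ∈ F, K.card = Fintype.card W := by
    have e1 : T.toFinset ⊆ Finset.univ \ F.biUnion id := fun x hx =>
      Finset.mem_sdiff.2 ⟨Finset.mem_univ x, fun h => Finset.disjoint_left.1 hUT h hx⟩
    have e2 := Finset.card_sdiff_add_card_eq_card e1
    rw [← hR] at e2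
    have e3 := Finset.card_sdiff_add_card_eq_card (Finset.subset_univ (F.biUnion id))
    have e4 : (F.biUnion id).card = ∑ K ∈ F, K.card :=
      Finset.card_biUnion fun K hK L hL => hpw K hK L hL
    rw [Finset.card_univ] at e3
    omega
  have hsum : (∑ K ∈ F, K.card) % 2 = F.card % 2 := by
    rw [Finset.sum_nat_mod, Finset.sum_congr rfl fun K hK => Nat.odd_iff.1 (hodd K hK)]
    simp
  have hRodd : Odd R.card := by
    rw [Nat.odd_iff]
    rw [Nat.even_iff] at heven
    omega
  have hRF : ∀ K ∈ F, Disjoint R K := fun K hK =>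
    Finset.disjoint_left.2 fun x hx => ((hRmem x).1 hx).1 K hK
  have hRnot : R ∉ F := fun h => by
    have h1 := hRF R h
    rw [disjoint_self, Finset.bot_eq_empty] at h1
    rw [h1] at hRodd
    simp at hRodd
  refine ⟨T.toFinset, insert R F, ?_, ?_, ?_, ?_, ?_⟩
  · intro K hK L hL hne
    rcases Finset.mem_insert.1 hK with rfl | hK <;> rcases Finset.mem_insert.1 hL with rfl | hL
    · exact absurd rfl hne
    · exact hRF L hL
    · exact (hRF K hK).symm
    · exact hpw K hK L hL hne
  · intro K hK
    rcases Finset.mem_insert.1 hK with rfl | hK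
    · exact hRodd
    · exact hodd K hK
  · intro K hK
    rcases Finset.mem_insert.1 hK with rfl | hK
    · exact Finset.sdiff_disjoint
    · exact hdis K hK
  · intro K hK
    rcases Finset.mem_insert.1 hK with rfl | hK
    · intro x hx y hxy
      by_contra! hy
      obtain ⟨hy1, hy2⟩ := hy
      rw [hRmem] at hy1 hx
      have : ∃ L ∈ F, y ∈ L := by
        by_contra! hn
        exact hy1 ⟨hn, hy2⟩
      obtain ⟨L, hL, hyL⟩ := this
      rcases hcl L hL y hyL x hxy.symm with h1 | h1
      · exact hx.1 L hL h1
      · exact hx.2 h1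
    · exact hcl K hK
  · rw [Finset.card_insert_of_notMem hRnot]
    omega

end

section

variable {V : Type*} {G : SimpleGraph V}

theorem deleteEdges_singleton_adj {u v x y : V} :
    (G.deleteEdges {s(u, v)}).Adj x y ↔ G.Adj x y ∧ ¬ (x = u ∧ y = v) ∧ ¬ (x = v ∧ y = u) := by
  simp

theorem Good.connected_deleteEdges [Fintype V] (hG : Good G) (hconn : G.Connected) {u v : V} (huv : u ≠ v) :
    (G.deleteEdges {s(u, v)}).Connected := by
  classical
  refine hconn.connected_delete_edge_of_not_isBridge ?_
  rw [isBridge_iff, not_not]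
  by_contra hn
  obtain ⟨y, hy, huy⟩ := hG.deg u {u, v} (Finset.card_le_two.trans (by norm_num))
  simp only [Finset.mem_insert, Finset.mem_singleton, not_or] at hy
  set A := Finset.univ.filter fun x => (G.deleteEdges {s(u, v)}).Reachable u x with hA
  have hmem : ∀ x, x ∈ A ↔ (G.deleteEdges {s(u, v)}).Reachable u x := by simp [hA]
  refine hG.not_sep_one (A := A.erase u) (a := y) (r := v) (x := u) ?_ ?_ huv.symm ?_
  · refine Finset.mem_erase.2 ⟨hy.1, (hmem y).2 (Adj.reachable ?_)⟩
    rw [deleteEdges_singleton_adj]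
    exact ⟨huy, fun h => hy.2 h.2, fun h => hy.1 h.2⟩
  · exact fun h => hn ((hmem v).1 (Finset.mem_of_mem_erase h))
  · intro w hw t hwt
    obtain ⟨hwu, hw⟩ := Finset.mem_erase.1 hw
    rw [hmem] at hw
    by_cases htu : t = u
    · exact Or.inr htu
    refine Or.inl (Finset.mem_erase.2 ⟨htu, (hmem t).2 (hw.trans (Adj.reachable ?_))⟩)
    rw [deleteEdges_singleton_adj]
    exact ⟨hwt, fun h => hwu h.1, fun h => htu h.2⟩

theorem Good.exists_involution_deleteEdges (hG : Good G) {u v : V} (huv : u ≠ v) :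
    ∃ σ : V → V, (∀ x, σ (σ x) = x) ∧ ∀ x, (G.deleteEdges {s(u, v)}).Adj x (σ x) := by
  classical
  obtain ⟨a, ha, hua⟩ := hG.deg u {v} (by simp)
  obtain ⟨b, hb, hvb⟩ := hG.deg v {u, a} (Finset.card_le_two.trans (by norm_num))
  simp only [Finset.mem_insert, Finset.mem_singleton, not_or] at ha hb
  obtain ⟨σ, hσ, hadj, hσu, hσv⟩ := hG.ext u a v b hua hvb huv (Ne.symm hb.1) ha (Ne.symm hb.2)
  refine ⟨σ, hσ, fun x => deleteEdges_singleton_adj.2 ⟨hadj x, ?_, ?_⟩⟩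
  · rintro ⟨rfl, h⟩
    exact ha (hσu.symm.trans h)
  · rintro ⟨rfl, h⟩
    exact hb.1 (hσv.symm.trans h)

/-- If two disjoint edges do not extend to a perfect matching, then Tutte's theorem gives a set
containing them with many odd closed sets outside. -/
theorem exists_family_of_edges [Fintype V] [DecidableEq V] {H : SimpleGraph V} (heven : Even (Fintype.card V))
    {a b c e : V} (hab : H.Adj a b) (hce : H.Adj c e) (h1 : a ≠ c) (h2 : a ≠ e) (h3 : b ≠ c)
    (h4 : b ≠ e)
    (hH : ¬ ∃ σ : V → V, (∀ x, σ (σ x) = x) ∧ (∀ x, H.Adj x (σ x)) ∧ σ a = b ∧ σ c = e) :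
    ∃ (S : Finset V) (F : Finset (Finset V)), ({a, b, c, e} : Finset V) ⊆ S ∧
      (∀ K ∈ F, ∀ L ∈ F, K ≠ L → Disjoint K L) ∧ (∀ K ∈ F, Odd K.card) ∧
      (∀ K ∈ F, Disjoint K S) ∧ (∀ K ∈ F, ClosedIn H S K) ∧ S.card ≤ F.card + 2 := by
  set X : Finset V := {a, b, c, e} with hX
  have hXc : X.card = 4 := by
    have := hab.ne; have := hce.ne
    rw [hX, Finset.card_insert_of_notMem, Finset.card_insert_of_notMem,
      Finset.card_insert_of_notMem, Finset.card_singleton] <;> simp_all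
  have hW : Even (Fintype.card {x // x ∉ X}) := by
    rw [Fintype.card_subtype_compl, Fintype.card_coe, hXc]
    have : X.card ≤ Fintype.card V := Finset.card_le_univ X
    rw [Nat.even_sub (by omega)]
    simp [heven]
    decide
  have hno : ¬ ∃ σ : {x // x ∉ X} → {x // x ∉ X}, (∀ x, σ (σ x) = x) ∧
      ∀ x, (H.comap (Subtype.val : {x // x ∉ X} → V)).Adj x (σ x) := by
    rintro ⟨σ, hσ, hadj⟩
    have hπ : ∀ x ∈ X, Equiv.swap a b (Equiv.swap c e x) ∈ X ∧
        H.Adj x (Equiv.swap a b (Equiv.swap c e x)) ∧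
        Equiv.swap a b (Equiv.swap c e (Equiv.swap a b (Equiv.swap c e x))) = x := by
      have := hab.symm
      have := hce.symm
      intro x hx
      simp only [hX, Finset.mem_insert, Finset.mem_singleton] at hx ⊢
      rcases hx with rfl | rfl | rfl | rfl <;> simp_all [Equiv.swap_apply_of_ne_of_ne, Ne.symm]
    refine hH ⟨fun x => if h : x ∉ X then σ ⟨x, h⟩ else Equiv.swap a b (Equiv.swap c e x),
      ?_, ?_, ?_, ?_⟩
    · intro x
      by_cases h : x ∈ X
      · simp [h, (hπ x h).1, (hπ x h).2.2]
      · have := (σ ⟨x, h⟩).2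
        simp only [h, this, hσ, not_false_eq_true, dite_true, Subtype.coe_eta]
    · intro x
      by_cases h : x ∈ X
      · simpa [h] using (hπ x h).2.1
      · simpa [h] using hadj ⟨x, h⟩
    · simp [hX, Equiv.swap_apply_of_ne_of_ne, h1, h2]
    · simp [hX, Equiv.swap_apply_of_ne_of_ne, h2.symm, h4.symm]
  obtain ⟨T, F, hdis, hodd, hFT, hcl, hle⟩ :=
    exists_family_of_no_involution (H := H.comap (Subtype.val : {x // x ∉ X} → V)) hW hno
  have hd : Disjoint (T.map (Function.Embedding.subtype _)) X := by
    rw [Finset.disjoint_left]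
    simp +contextual
  refine ⟨T.map (Function.Embedding.subtype _) ∪ X,
    F.image fun K => K.map (Function.Embedding.subtype _), Finset.subset_union_right,
    ?_, ?_, ?_, ?_, ?_⟩
  · simp only [Finset.mem_image, forall_exists_index, and_imp, forall_apply_eq_imp_iff₂]
    intro K hK L hL hne
    rw [Finset.disjoint_map]
    exact hdis K hK L hL (fun h => hne (h ▸ rfl))
  · simpa using hodd
  · simp only [Finset.mem_image, forall_exists_index, and_imp, forall_apply_eq_imp_iff₂]
    intro K hK
    rw [Finset.disjoint_union_right, Finset.disjoint_map]
    refine ⟨hFT K hK, ?_⟩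
    rw [Finset.disjoint_left]
    simp +contextual
  · simp only [Finset.mem_image, forall_exists_index, and_imp, forall_apply_eq_imp_iff₂]
    intro K hK x hx y hxy
    obtain ⟨x', hx', rfl⟩ := Finset.mem_map.1 hx
    by_cases hy : y ∈ X
    · exact Or.inr (Finset.mem_union_right _ hy)
    · rcases hcl K hK x' hx' ⟨y, hy⟩ hxy with h | h
      · exact Or.inl (Finset.mem_map.2 ⟨_, h, rfl⟩)
      · exact Or.inr (Finset.mem_union_left _ (Finset.mem_map.2 ⟨_, h, rfl⟩))
  · rw [Finset.card_union_of_disjoint hd, Finset.card_map, hXc,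
      Finset.card_image_of_injective _ (Finset.map_injective _)]
    omega

theorem Good.exists_barrier (hG : Good G) [DecidableEq V] {u v : V} {S : Finset V}
    {F : Finset (Finset V)} (hS : TwoEdges G S)
    (hdis : ∀ K ∈ F, ∀ L ∈ F, K ≠ L → Disjoint K L) (hodd : ∀ K ∈ F, Odd K.card)
    (hFS : ∀ K ∈ F, Disjoint K S) (hcl : ∀ K ∈ F, ClosedIn (G.deleteEdges {s(u, v)}) S K)
    (hle : S.card ≤ F.card + 2) : ∃ A B F', Barrier G u v S A B F' := by
  classical
  have hopen : ∀ K ∈ F, ¬ ClosedIn G S K →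
      (u ∈ K ∧ v ∉ K ∧ v ∉ S) ∨ (v ∈ K ∧ u ∉ K ∧ u ∉ S) := by
    intro K hK hn
    simp only [ClosedIn] at hn
    push Not at hn
    obtain ⟨x, hx, y, hxy, hyK, hyS⟩ := hn
    have := mt (hcl K hK x hx y) (by tauto)
    rw [deleteEdges_singleton_adj] at this
    by_cases h1 : x = u ∧ y = v
    · obtain ⟨rfl, rfl⟩ := h1
      exact Or.inl ⟨hx, hyK, hyS⟩
    · have h2 : x = v ∧ y = u := by tauto
      obtain ⟨rfl, rfl⟩ := h2
      exact Or.inr ⟨hx, hyK, hyS⟩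
  have hsum := Finset.card_filter_add_card_filter_not (s := F) (ClosedIn G S)
  have hc := hG.card_le hS (F.filter (ClosedIn G S))
    (fun K hK L hL => hdis K (Finset.mem_filter.1 hK).1 L (Finset.mem_filter.1 hL).1)
    (fun K hK => hodd K (Finset.mem_filter.1 hK).1)
    (fun K hK => hFS K (Finset.mem_filter.1 hK).1) (fun K hK => (Finset.mem_filter.1 hK).2)
  have hex : ∃ A ∈ F, ∃ B ∈ F, A ≠ B ∧ u ∈ A ∧ v ∈ B := by
    obtain ⟨A, hA, B, hB, hne⟩ := Finset.one_lt_card.1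
      (show 1 < (F.filter fun K => ¬ ClosedIn G S K).card by omega)
    rw [Finset.mem_filter] at hA hB
    have hd := hdis A hA.1 B hB.1 hne
    rw [Finset.disjoint_left] at hd
    rcases hopen A hA.1 hA.2 with h | h <;> rcases hopen B hB.1 hB.2 with h' | h'
    · exact absurd h'.1 (hd h.1)
    · exact ⟨A, hA.1, B, hB.1, hne, h.1, h'.1⟩
    · exact ⟨B, hB.1, A, hA.1, hne.symm, h'.1, h.1⟩
    · exact absurd h'.1 (hd h.1)
  obtain ⟨A, hA, B, hB, hne, huA, hvB⟩ := hex
  have hd : ∀ K ∈ F, ∀ L ∈ F, K ≠ L → ∀ x ∈ K, x ∉ L := fun K hK L hL h x hx hx' =>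
    Finset.disjoint_left.1 (hdis K hK L hL h) hx hx'
  have hsep : ∀ K ∈ F, ∀ x ∈ K, x ∉ S := fun K hK x hx hx' =>
    Finset.disjoint_left.1 (hFS K hK) hx hx'
  have hsub : (F.filter fun K => ¬ ClosedIn G S K) ⊆ {A, B} := by
    intro K hK
    rw [Finset.mem_filter] at hK
    simp only [Finset.mem_insert, Finset.mem_singleton]
    by_contra! hn
    rcases hopen K hK.1 hK.2 with h | h
    · exact hd K hK.1 A hA hn.1 u h.1 huA
    · exact hd K hK.1 B hB hn.2 v h.1 hvB
  have h2 := (Finset.card_le_card hsub).trans Finset.card_le_two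
  have hnot : (F.filter fun K => ¬ ClosedIn G S K) = {A, B} :=
    Finset.eq_of_subset_of_card_le hsub (by rw [Finset.card_pair hne]; omega)
  have hAo : ¬ ClosedIn G S A := by
    have : A ∈ F.filter fun K => ¬ ClosedIn G S K := by simp [hnot]
    exact (Finset.mem_filter.1 this).2
  have hBo : ¬ ClosedIn G S B := by
    have : B ∈ F.filter fun K => ¬ ClosedIn G S K := by simp [hnot]
    exact (Finset.mem_filter.1 this).2
  have hcl' : ∀ K ∈ F, ∀ x ∈ K, ∀ y, G.Adj x y →
      y ∈ K ∨ y ∈ S ∨ (x = u ∧ y = v) ∨ (x = v ∧ y = u) := by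
    intro K hK x hx y hxy
    by_cases h : (x = u ∧ y = v) ∨ (x = v ∧ y = u)
    · exact Or.inr (Or.inr h)
    · have := hcl K hK x hx y (deleteEdges_singleton_adj.2 ⟨hxy, by tauto, by tauto⟩)
      tauto
  refine ⟨A, B, F.filter (ClosedIn G S), hS, huA, hvB, hodd A hA, hodd B hB, hd A hA B hB hne,
    hsep A hA, hsep B hB, by omega, ?_, ?_, ?_, ?_, ?_, ?_, ?_, ?_⟩
  · exact fun K hK L hL => hdis K (Finset.mem_filter.1 hK).1 L (Finset.mem_filter.1 hL).1
  · exact fun K hK => hodd K (Finset.mem_filter.1 hK).1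
  · exact fun K hK => hsep K (Finset.mem_filter.1 hK).1
  · intro K hK
    rw [Finset.mem_filter] at hK
    exact hd K hK.1 A hA (fun h => hAo (h ▸ hK.2))
  · intro K hK
    rw [Finset.mem_filter] at hK
    exact hd K hK.1 B hB (fun h => hBo (h ▸ hK.2))
  · intro x hx y hxy
    have := hcl' A hA x hx y hxy
    have h3 : x ≠ v := fun h => hd A hA B hB hne x hx (h ▸ hvB)
    tauto
  · intro x hx y hxy
    have := hcl' B hB x hx y hxy
    have h3 : x ≠ u := fun h => hd B hB A hA hne.symm x hx (h ▸ huA)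
    tauto
  · exact fun K hK => (Finset.mem_filter.1 hK).2

theorem exists_irreducible [DecidableEq V] {u v : V} :
    ∀ (n : ℕ) {S A B : Finset V} {F : Finset (Finset V)}, S.card = n → Barrier G u v S A B F →
      ∃ S A B F, Barrier G u v S A B F ∧ Irreducible2 G u v S := by
  intro n
  induction n with
  | zero =>
    intro S A B F h0 h
    exact ⟨S, A, B, F, h, fun d hd => by simp_all⟩
  | succ n ih =>
    intro S A B F hn h
    by_cases hirr : Irreducible2 G u v S
    · exact ⟨S, A, B, F, h, hirr⟩
    · simp only [Irreducible2, not_forall, not_not] at hirr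
      obtain ⟨d, hd, A', B', F', h'⟩ := hirr
      exact ih (by rw [Finset.card_erase_of_mem hd]; omega) h'

theorem MinimalKExt.exists_barrier [Fintype V] [DecidableEq V] (hG : Good G) (hmin : MinimalKExt G 2) (u v : V)
    (huv : G.Adj u v) : ∃ S A B F, Barrier G u v S A B F ∧ Irreducible2 G u v S := by
  have hconn := hG.connected_deleteEdges hmin.1.1 huv.ne
  obtain ⟨τ, hτ, hτG⟩ := hG.exists_involution_deleteEdges huv.ne
  have hnot : ¬ ∀ a b c e, (G.deleteEdges {s(u, v)}).Adj a b → (G.deleteEdges {s(u, v)}).Adj c e →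
      a ≠ c → a ≠ e → b ≠ c → b ≠ e → ∃ σ : V → V, (∀ x, σ (σ x) = x) ∧
        (∀ x, (G.deleteEdges {s(u, v)}).Adj x (σ x)) ∧ σ a = b ∧ σ c = e :=
    fun h => hmin.2 s(u, v) huv (KExt.of_involution hconn hτ hτG h)
  push Not at hnot
  obtain ⟨a, b, c, e, hab, hce, h1, h2, h3, h4, hn⟩ := hnot
  have heven : Even (Fintype.card V) :=
    even_card_of_invariant hτ (fun x => (hτG x).ne') Finset.univ (fun _ _ => Finset.mem_univ _)
  obtain ⟨S, F, hsub, hdis, hodd, hFS, hcl, hle⟩ :=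
    exists_family_of_edges heven hab hce h1 h2 h3 h4 (by push Not; exact hn)
  have hS : TwoEdges G S := ⟨a, hsub (by simp), b, hsub (by simp), c, hsub (by simp), e,
    hsub (by simp), (deleteEdges_singleton_adj.1 hab).1, (deleteEdges_singleton_adj.1 hce).1,
    h1, h2, h3, h4⟩
  obtain ⟨A, B, F', h⟩ := hG.exists_barrier hS hdis hodd hFS hcl hle
  exact exists_irreducible _ rfl h

end

section

variable {V : Type*} {G : SimpleGraph V} {u v : V} {S A B : Finset V} {F : Finset (Finset V)}

theorem Ge_adj {x y : ↑((S : Set V)ᶜ)} : (Ge G u v S).Adj x y ↔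
    G.Adj x y ∧ ¬ ((x : V) = u ∧ (y : V) = v) ∧ ¬ ((x : V) = v ∧ (y : V) = u) :=
  deleteEdges_singleton_adj

theorem compFinset_Ge_closed [Fintype V] (C : (Ge G u v S).ConnectedComponent) :
    ∀ x ∈ compFinset C, ∀ y, G.Adj x y →
      y ∈ compFinset C ∨ y ∈ S ∨ (x = u ∧ y = v) ∨ (x = v ∧ y = u) := by
  intro x hx y hxy
  by_contra! hn
  refine hn.1 (compFinset_closed hx (by simpa using hn.2.1) fun _ _ => Ge_adj.2 ⟨hxy, ?_, ?_⟩)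
  · exact fun h => hn.2.2.1 h.1 h.2
  · exact fun h => hn.2.2.2 h.1 h.2

theorem notMem_of_mem_compFinset_Ge [Fintype V] {C : (Ge G u v S).ConnectedComponent} {x : V}
    (hx : x ∈ compFinset C) : x ∉ S := by
  obtain ⟨h, -⟩ := mem_compFinset.1 hx
  simpa using h

theorem Admissible.exists_barrier [Fintype V] (h : Admissible G 2 u v S) :
    ∃ A B F, Barrier G u v S A B F := by
  classical
  obtain ⟨huS, hvS, ⟨M, hM, hMS, hM2⟩, hcard, hu, hv, hne, hou, hov⟩ := h
  obtain ⟨a, b, c, e, hab, hce, -, h1, h2, h3, h4⟩ := exists_edges_of_matching hM hM2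
  set Cu := (Ge G u v S).connectedComponentMk ⟨u, hu⟩
  set Cv := (Ge G u v S).connectedComponentMk ⟨v, hv⟩
  have huC : u ∈ compFinset Cu := mem_compFinset.2 ⟨hu, rfl⟩
  have hvC : v ∈ compFinset Cv := mem_compFinset.2 ⟨hv, rfl⟩
  have hdis : ∀ {C C' : (Ge G u v S).ConnectedComponent}, C ≠ C' →
      ∀ x ∈ compFinset C, x ∉ compFinset C' := fun hC x hx =>
    Finset.disjoint_left.1 (disjoint_compFinset hC) hx
  set O := Finset.univ.filter fun C : (Ge G u v S).ConnectedComponent => Odd C.supp.ncard with hO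
  have hOcard : O.card + 2 * 2 = S.card + 2 := by
    rw [Set.ncard_coe_finset] at hcard
    rw [← hcard, hO, ← Set.ncard_coe_finset]
    simp
  have hsub : ({Cu, Cv} : Finset _) ⊆ O := by
    intro C hC
    simp only [Finset.mem_insert, Finset.mem_singleton] at hC
    rcases hC with rfl | rfl <;> simpa [hO]
  have hFcard := Finset.card_sdiff_add_card_eq_card hsub
  rw [Finset.card_pair hne] at hFcard
  have hF : ∀ K ∈ (O \ {Cu, Cv}).image compFinset, ∃ C : (Ge G u v S).ConnectedComponent,
      compFinset C = K ∧ Odd C.supp.ncard ∧ C ≠ Cu ∧ C ≠ Cv := by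
    intro K hK
    obtain ⟨C, hC, rfl⟩ := Finset.mem_image.1 hK
    simp only [hO, Finset.mem_sdiff, Finset.mem_filter, Finset.mem_univ, true_and,
      Finset.mem_insert, Finset.mem_singleton, not_or] at hC
    exact ⟨C, rfl, hC⟩
  refine ⟨compFinset Cu, compFinset Cv, (O \ {Cu, Cv}).image compFinset, ?_, huC, hvC, ?_, ?_,
    hdis hne, fun x => notMem_of_mem_compFinset_Ge, fun x => notMem_of_mem_compFinset_Ge,
    ?_, ?_, ?_, ?_, ?_, ?_, ?_, ?_, ?_⟩
  · exact ⟨a, hMS (M.edge_vert hab), b, hMS (M.edge_vert hab.symm), c, hMS (M.edge_vert hce), e,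
      hMS (M.edge_vert hce.symm), hab.adj_sub, hce.adj_sub, h1, h2, h3, h4⟩
  · rwa [card_compFinset]
  · rwa [card_compFinset]
  · rw [Finset.card_image_of_injective _ compFinset_injective]
    omega
  · intro K hK L hL hKL
    obtain ⟨C, rfl, -⟩ := hF K hK
    obtain ⟨C', rfl, -⟩ := hF L hL
    exact disjoint_compFinset fun h => hKL (h ▸ rfl)
  · intro K hK
    obtain ⟨C, rfl, hC, -⟩ := hF K hK
    rwa [card_compFinset]
  · intro K hK
    obtain ⟨C, rfl, -⟩ := hF K hK
    exact fun x => notMem_of_mem_compFinset_Ge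
  · intro K hK
    obtain ⟨C, rfl, -, hC, -⟩ := hF K hK
    exact hdis hC
  · intro K hK
    obtain ⟨C, rfl, -, -, hC⟩ := hF K hK
    exact hdis hC
  · intro x hx y hxy
    have := compFinset_Ge_closed Cu x hx y hxy
    have h5 : x ≠ v := fun h => hdis hne x hx (h ▸ hvC)
    tauto
  · intro x hx y hxy
    have := compFinset_Ge_closed Cv x hx y hxy
    have h5 : x ≠ u := fun h => hdis hne.symm x hx (h ▸ huC)
    tauto
  · intro K hK x hx y hxy
    obtain ⟨C, rfl, -, hCu, hCv⟩ := hF K hK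
    have := compFinset_Ge_closed C x hx y hxy
    have h5 : x ≠ u := fun h => hdis hCu x hx (h ▸ huC)
    have h6 : x ≠ v := fun h => hdis hCv x hx (h ▸ hvC)
    tauto

theorem Barrier.compFinset_left [Fintype V] [DecidableEq V] (hG : Good G) (h : Barrier G u v S A B F) (h4 : S.card = 4)
    {D : SimpleGraph ↑((S : Set V)ᶜ)}
    (hD : ∀ x y, D.Adj x y ↔
      G.Adj x y ∧ ¬ ((x : V) = u ∧ (y : V) = v) ∧ ¬ ((x : V) = v ∧ (y : V) = u))
    (hu : u ∈ (S : Set V)ᶜ) :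
    compFinset (D.connectedComponentMk ⟨u, hu⟩) ⊆ A ∧
      Odd (compFinset (D.connectedComponentMk ⟨u, hu⟩)).card := by
  have hsub : compFinset (D.connectedComponentMk ⟨u, hu⟩) ⊆ A := by
    refine compFinset_subset h.left_mem fun y z hy hyz => ?_
    rw [hD] at hyz
    have h1 := h.closed_left y hy z hyz.1
    have h2 : (z : V) ∉ S := fun hz => z.2 hz
    tauto
  refine ⟨hsub, ?_⟩
  have huC : u ∈ compFinset (D.connectedComponentMk ⟨u, hu⟩) := mem_compFinset.2 ⟨hu, rfl⟩
  have heven : Even (A \ compFinset (D.connectedComponentMk ⟨u, hu⟩)).card := by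
    refine hG.even_card h.two h4 ?_ ?_
    · exact Finset.disjoint_left.2 fun x hx => h.left_sep x (Finset.mem_sdiff.1 hx).1
    · intro x hx y hxy
      rw [Finset.mem_sdiff] at hx ⊢
      have hxu : x ≠ u := fun e => hx.2 (e ▸ huC)
      rcases h.closed_left x hx.1 y hxy with hy | hy | hy
      · refine Or.inl ⟨hy, fun hyC => hx.2 ?_⟩
        refine compFinset_closed hyC (by simpa using h.left_sep x hx.1) fun _ _ =>
          (hD _ _).2 ⟨hxy.symm, fun e => ?_, fun e => hxu e.2⟩
        exact h.right_notMem_left (e.2 ▸ hx.1)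
      · exact Or.inr hy
      · exact absurd hy.1 hxu
  have hcard := Finset.card_sdiff_add_card_eq_card hsub
  have hodd := h.odd_left
  rw [← hcard, add_comm, Nat.odd_add] at hodd
  exact hodd.2 heven

theorem Barrier.admissible [Fintype V] [DecidableEq V] (hG : Good G) (h : Barrier G u v S A B F) (h4 : S.card = 4) :
    Admissible G 2 u v S := by
  have hu : u ∈ (S : Set V)ᶜ := by simpa using h.left_notMem_sep
  have hv : v ∈ (S : Set V)ᶜ := by simpa using h.right_notMem_sep
  obtain ⟨hsu, hou⟩ := h.compFinset_left hG h4 (fun _ _ => Ge_adj (G := G)) hu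
  obtain ⟨-, hov⟩ := h.symm.compFinset_left hG h4 (D := Ge G u v S)
    (fun _ _ => Ge_adj.trans (by tauto)) hv
  have hne : (Ge G u v S).connectedComponentMk ⟨u, hu⟩ ≠
      (Ge G u v S).connectedComponentMk ⟨v, hv⟩ := fun e =>
    h.right_notMem_left (hsu (mem_compFinset.2 ⟨hv, e.symm⟩))
  rw [card_compFinset] at hou hov
  have hO : {C : (Ge G u v S).ConnectedComponent | Odd C.supp.ncard} =
      {(Ge G u v S).connectedComponentMk ⟨u, hu⟩, (Ge G u v S).connectedComponentMk ⟨v, hv⟩} := by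
    ext C
    simp only [Set.mem_ofPred_eq, Set.mem_insert_iff, Set.mem_singleton_iff]
    constructor
    · intro hC
      by_contra! hn
      rw [← card_compFinset, ← Nat.not_even_iff_odd] at hC
      refine hC (hG.even_card h.two h4
        (Finset.disjoint_left.2 fun x => notMem_of_mem_compFinset_Ge) fun x hx y hxy => ?_)
      obtain ⟨hx1, hx2⟩ := mem_compFinset.1 hx
      have hxu : x ≠ u := by
        rintro rfl
        exact hn.1 hx2.symm
      have hxv : x ≠ v := by
        rintro rfl
        exact hn.2 hx2.symm
      have := compFinset_Ge_closed C x hx y hxy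
      tauto
    · rintro (rfl | rfl) <;> assumption
  obtain ⟨a, ha, b, hb, c, hc, e, he, hab, hce, h1, h2, h3, h5⟩ := h.two
  obtain ⟨M, hM, -, hM2, hMv⟩ := exists_matching_of_edges hab hce h1 h2 h3 h5
  refine ⟨hu, hv, ⟨M, hM, ?_, hM2.ge⟩, ?_, hu, hv, hne, hou, hov⟩
  · rw [hMv]
    rintro x (rfl | rfl | rfl | rfl) <;> assumption
  · rw [hO, Set.ncard_pair hne, Set.ncard_coe_finset, h4]

theorem Barrier.neighbor_iff_mem [DecidableEq V] (hG : Good G)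
    (hex : ∀ x y, G.Adj x y → ∃ S A B F, Barrier G x y S A B F ∧ Irreducible2 G x y S)
    (h : Barrier G u v S A B F) (hirr : Irreducible2 G u v S) (huv : G.Adj u v)
    (h5 : S.card = 5) (x : V) : G.Adj u x ∧ x ≠ v ↔ x ∈ S := by
  have hsub : ∀ y, G.Adj u y → y ∈ S ∨ y = v := by
    intro y huy
    rcases h.closed_left u h.left_mem y huy with hy | hy | hy
    · exact absurd huy (h.not_adj_of_mem_left hG hex hirr huv h5 hy)
    · exact Or.inl hy
    · exact Or.inr hy.2
  refine ⟨fun hx => (hsub x hx.1).resolve_right hx.2, fun hx => ?_⟩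
  obtain ⟨y, hy, huy⟩ := hG.deg u (insert v (S.erase x)) (by
    have := Finset.card_insert_le v (S.erase x)
    rw [Finset.card_erase_of_mem hx] at this
    omega)
  simp only [Finset.mem_insert, Finset.mem_erase, not_or, not_and] at hy
  obtain rfl : y = x := by
    by_contra hyx
    exact hy.2 hyx ((hsub y huy).resolve_right hy.1)
  exact ⟨huy, hy.1⟩

end

theorem stmt16 {V : Type*} [Fintype V] (G : SimpleGraph V) [DecidableRel G.Adj]
    (hclaw : ClawFree G) (hmin : MinimalKExt G 2) (hdelta : 6 ≤ G.minDegree)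
    (u v : V) (huv : G.Adj u v) (htype : EdgeType G u v 5) :
    G.neighborSet u \ {v} = G.neighborSet v \ {u} := by
  classical
  have hG := good_of_kExt hclaw hmin.1 hdelta
  have hex := hmin.exists_barrier hG
  obtain ⟨⟨S, hS, hS5⟩, hle⟩ := htype
  obtain ⟨S, rfl⟩ : ∃ T : Finset V, (T : Set V) = S := ⟨S.toFinset, by simp⟩
  rw [Set.ncard_coe_finset] at hS5
  obtain ⟨A, B, F, h⟩ := hS.exists_barrier
  have hirr : Irreducible2 G u v S := by
    intro d hd A' B' F' h'
    have hc : (S.erase d).card = 4 := by rw [Finset.card_erase_of_mem hd, hS5]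
    have := hle _ (h'.admissible hG hc)
    rw [Set.ncard_coe_finset, hc] at this
    omega
  ext x
  exact (h.neighbor_iff_mem hG hex hirr huv hS5 x).trans
    (h.symm.neighbor_iff_mem hG hex hirr.symm huv.symm hS5 x).symm
end

section
/- Let G be a finite simple claw-free minimal 2-extendable graph with δ(G) ≥ 6, and let uv be an edge of G of type 1. Then there exists a vertex cut X of G such that: |X| = 5; every maximum matching of the induced subgraph G[X] has size 2; v ∈ X; u lies in a connected component C_u of G − X of odd order; and uv is the only edge of G joining a vertex of C_u to v. -/
open SimpleGraph

/-- `X` is a vertex cut of `G`: deleting the vertices of `X` leaves a disconnected graph. -/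
def IsVertexCut {V : Type*} (G : SimpleGraph V) (X : Set V) : Prop :=
  ¬ (G.induce Xᶜ).Preconnected

open Classical in
theorem SimpleGraph.Subgraph.IsMatching.ncard_verts {V : Type*} [Finite V] {G : SimpleGraph V}
    {M : G.Subgraph} (hM : M.IsMatching) : M.verts.ncard = 2 * M.edgeSet.ncard := by
  have := Fintype.ofFinite V
  have hE : M.edgeSet.ncard = M.coe.edgeFinset.card := by
    rw [← M.image_coe_edgeSet_coe,
      Set.ncard_image_of_injective _ (Sym2.map.injective Subtype.val_injective),
      ← SimpleGraph.coe_edgeFinset, Set.ncard_coe_finset]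
  rw [hE, ← M.coe.sum_degrees_eq_twice_card_edges,
    Finset.sum_congr (g := fun _ => 1) rfl fun v _ => ?_]
  · simp [Set.ncard_eq_toFinset_card']
  · rw [SimpleGraph.Subgraph.coe_degree]
    convert SimpleGraph.Subgraph.isMatching_iff_forall_degree.mp hM v v.2

/-- If `v` is separated from `u` in `G - uv - S`, then deleting `v` together with `S` does not
change the component of `u`. -/
theorem reachable_insert_iff {V : Type*} {G : SimpleGraph V} {u v : V} {S : Set V}
    {hu : u ∈ Sᶜ} {hv : v ∈ Sᶜ} (hsep : ¬ (Ge G u v S).Reachable ⟨u, hu⟩ ⟨v, hv⟩)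
    (hu' : u ∈ (insert v S)ᶜ) (w : V) (hw : w ∈ Sᶜ) :
    (Ge G u v S).Reachable ⟨u, hu⟩ ⟨w, hw⟩ ↔
      ∃ hw' : w ∈ (insert v S)ᶜ, (G.induce (insert v S)ᶜ).Reachable ⟨u, hu'⟩ ⟨w, hw'⟩ := by
  have hmem {x : V} (hx : x ∈ Sᶜ) (hr : (Ge G u v S).Reachable ⟨u, hu⟩ ⟨x, hx⟩) :
      x ∈ (insert v S)ᶜ := by
    rintro (rfl | h)
    exacts [hsep hr, hx h]
  constructor
  · intro hr
    refine ⟨hmem hw hr, ?_⟩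
    suffices ∀ x : ↑Sᶜ, (hx : (Ge G u v S).Reachable ⟨u, hu⟩ x) →
        (G.induce (insert v S)ᶜ).Reachable ⟨u, hu'⟩ ⟨x, hmem x.2 hx⟩ from this ⟨w, hw⟩ hr
    intro x hx
    have hx' := (SimpleGraph.reachable_iff_reflTransGen _ _).mp hx
    induction hx' with
    | refl => exact SimpleGraph.Reachable.rfl
    | @tail b c hb hbc ih =>
      have hb' := (SimpleGraph.reachable_iff_reflTransGen _ _).mpr hb
      refine (ih hb').trans (SimpleGraph.Adj.reachable ?_)
      have : (G.deleteEdges {s(u, v)}).Adj b c := hbc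
      exact (SimpleGraph.deleteEdges_adj.mp this).1
  · rintro ⟨hw', hr⟩
    let f : G.induce (insert v S)ᶜ →g Ge G u v S :=
      { toFun := fun x => ⟨x, fun h => x.2 (Or.inr h)⟩
        map_rel' := by
          intro a b hab
          have ha : (a : V) ≠ v := fun h => a.2 (Or.inl h)
          have hb : (b : V) ≠ v := fun h => b.2 (Or.inl h)
          have : (G.deleteEdges {s(u, v)}).Adj a b := by
            refine SimpleGraph.deleteEdges_adj.mpr ⟨hab, ?_⟩
            simp [ha, hb]
          exact this }
    exact hr.map f


theorem stmt18 {V : Type*} [Fintype V] (G : SimpleGraph V) [DecidableRel G.Adj]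
    (hclaw : ClawFree G) (hmin : MinimalKExt G 2) (hdelta : 6 ≤ G.minDegree)
    (u v : V) (huv : G.Adj u v) (htype : EdgeType G u v 4) :
    ∃ X : Set V, IsVertexCut G X ∧ X.ncard = 5 ∧
      (∀ M : G.Subgraph, M.IsMatching → M.verts ⊆ X →
        (∀ M' : G.Subgraph, M'.IsMatching → M'.verts ⊆ X →
          M'.edgeSet.ncard ≤ M.edgeSet.ncard) →
        M.edgeSet.ncard = 2) ∧
      v ∈ X ∧
      ∃ (hu : u ∈ Xᶜ),
        Odd ((G.induce Xᶜ).connectedComponentMk ⟨u, hu⟩).supp.ncard ∧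
        ∀ w, ∀ (hw : w ∈ Xᶜ),
          (G.induce Xᶜ).connectedComponentMk ⟨w, hw⟩ =
            (G.induce Xᶜ).connectedComponentMk ⟨u, hu⟩ →
          G.Adj w v → w = u := by
  classical
  obtain ⟨⟨S, ⟨-, -, ⟨M₀, hM₀, hM₀S, hM₀2⟩, -, hu, hv, hne, hodd, -⟩, hS⟩, -⟩ := htype
  have hsep : ¬ (Ge G u v S).Reachable ⟨u, hu⟩ ⟨v, hv⟩ := fun h =>
    hne (SimpleGraph.ConnectedComponent.eq.mpr h)
  have hu' : u ∈ (insert v S)ᶜ := by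
    rintro (h | h)
    exacts [huv.ne h, hu h]
  have hcard : (insert v S).ncard = 5 := by
    rw [Set.ncard_insert_of_notMem hv, hS]
  have huniq : ∀ w, ∀ hw : w ∈ (insert v S)ᶜ,
      (G.induce (insert v S)ᶜ).Reachable ⟨u, hu'⟩ ⟨w, hw⟩ → G.Adj w v → w = u := by
    intro w hw hr hadj
    by_contra hwu
    have hwS : w ∈ Sᶜ := fun h => hw (Or.inr h)
    refine hsep (((reachable_insert_iff hsep hu' w hwS).mpr ⟨hw, hr⟩).trans
      (SimpleGraph.Adj.reachable ?_))
    have : (G.deleteEdges {s(u, v)}).Adj w v :=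
      SimpleGraph.deleteEdges_adj.mpr ⟨hadj, by simp [hwu, hadj.ne]⟩
    exact this
  refine ⟨insert v S, fun hpre => ?_, hcard, fun M hM hMX hmax => ?_, Set.mem_insert _ _, hu', ?_,
    fun w hw hwu => huniq w hw (SimpleGraph.ConnectedComponent.eq.mp hwu).symm⟩
  · have hsub : G.neighborSet v ⊆ insert u S := by
      intro w hw
      by_contra hwn
      have hw' : w ∈ (insert v S)ᶜ := by
        rintro (h | h)
        exacts [(G.ne_of_adj hw).symm h, hwn (Or.inr h)]
      exact hwn (Or.inl (huniq w hw' (hpre _ _) (G.adj_symm hw)))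
    have h1 := Set.ncard_le_ncard hsub
    have h2 : (insert u S).ncard = 5 := by
      rw [Set.ncard_insert_of_notMem hu, hS]
    have h3 : (G.neighborSet v).ncard = G.degree v := by
      rw [Set.ncard_eq_toFinset_card', ← G.neighborFinset_def, G.card_neighborFinset_eq_degree]
    have h4 := G.minDegree_le_degree v
    omega
  · have h1 := Set.ncard_le_ncard hMX
    rw [hM.ncard_verts, hcard] at h1
    have h2 := hmax M₀ hM₀ (hM₀S.trans (Set.subset_insert _ _))
    omega
  · convert hodd using 1
    rw [← Set.ncard_image_of_injective _ Subtype.val_injective,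
      ← Set.ncard_image_of_injective (SimpleGraph.ConnectedComponent.supp _)
        Subtype.val_injective]
    congr 1
    ext w
    simp only [Set.mem_image, SimpleGraph.ConnectedComponent.mem_supp_iff, Subtype.exists,
      exists_and_right, exists_eq_right, SimpleGraph.ConnectedComponent.eq]
    constructor
    · rintro ⟨hw, hr⟩
      have hwS : w ∈ Sᶜ := fun h => hw (Or.inr h)
      exact ⟨hwS, ((reachable_insert_iff hsep hu' w hwS).mpr ⟨hw, hr.symm⟩).symm⟩
    · rintro ⟨hw, hr⟩
      obtain ⟨hw', hr'⟩ := (reachable_insert_iff hsep hu' w hw).mp hr.symm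
      exact ⟨hw', hr'.symm⟩
end
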